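/- arXiv:2301.07083 — 4 statements merged into one kernel-verified Lean document; each statement's English description precedes it below -/
import Mathlib

section
/- Klainerman–Sobolev inequality on hyperboloids: There is a constant C > 0 such that for every ρ > 0 and every C² function f : ℝ × ℝ³ → ℝ supported in the region {(t,x) : |x| ≤ t − 1}, one has sup_{(t,x) ∈ H_ρ} t^{3/2} |f(t,x)| ≤ C Σ_{|J| ≤ 2} ‖L^J f‖_{L²(H_ρ)}, where L^J ranges over compositions of at most two boost vector fields Ω_{01}, Ω_{02}, Ω_{03}. -/
noncomputable section

open Real MeasureTheory

abbrev E3 : Type := EuclideanSpace ℝ (Fin 3)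

/-- Time partial derivative `∂_t f`. -/
def dt (f : ℝ × E3 → ℝ) (p : ℝ × E3) : ℝ := fderiv ℝ f p (1, 0)

/-- Spatial partial derivative `∂_{x_i} f`. -/
def dx (i : Fin 3) (f : ℝ × E3 → ℝ) (p : ℝ × E3) : ℝ :=
  fderiv ℝ f p (0, EuclideanSpace.single i 1)

/-- Boost vector field `Ω_{0i} f = t ∂_{x_i} f + x_i ∂_t f`. -/
def boost (i : Fin 3) (f : ℝ × E3 → ℝ) (p : ℝ × E3) : ℝ :=
  p.1 * dx i f p + p.2 i * dt f p

/-- The point of the hyperboloid `H_ρ` lying over `x ∈ ℝ³`. -/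
def hLift (ρ : ℝ) (x : E3) : ℝ × E3 := (Real.sqrt (ρ ^ 2 + ‖x‖ ^ 2), x)

/-- The hyperboloid `H_ρ = {(t,x) : t > 0, t² − |x|² = ρ²}`. -/
def Hyp (ρ : ℝ) : Set (ℝ × E3) := {p : ℝ × E3 | 0 < p.1 ∧ p.1 ^ 2 - ‖p.2‖ ^ 2 = ρ ^ 2}

/-- The `L²` norm on the hyperboloid `H_ρ`, with respect to the measure `dx`. -/
def L2H (ρ : ℝ) (g : ℝ × E3 → ℝ) : ℝ := Real.sqrt (∫ x : E3, (g (hLift ρ x)) ^ 2)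

/-- Integration in polar coordinates for nonnegative functions. -/
theorem lintegral_eq_lintegral_toSphere {E : Type*} [NormedAddCommGroup E] [NormedSpace ℝ E]
    [MeasurableSpace E] [BorelSpace E] [FiniteDimensional ℝ E] [Nontrivial E]
    (μ : Measure E) [μ.IsAddHaarMeasure] {F : E → ENNReal} (hF : Measurable F) :
    ∫⁻ x, F x ∂μ = ∫⁻ ω : Metric.sphere (0 : E) 1, ∫⁻ r in Set.Ioi (0 : ℝ),
      ENNReal.ofReal (r ^ (Module.finrank ℝ E - 1)) * F (r • (ω : E)) ∂volume ∂μ.toSphere := by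
  have hsymm : Measurable fun z : Metric.sphere (0 : E) 1 × Set.Ioi (0 : ℝ) =>
      F ((z.2 : ℝ) • (z.1 : E)) := by
    apply hF.comp
    fun_prop
  calc
    ∫⁻ x, F x ∂μ = ∫⁻ x : ({0}ᶜ : Set E), F x ∂(μ.comap (↑)) := by
      rw [lintegral_subtype_comap (measurableSet_singleton _).compl, restrict_compl_singleton]
    _ = ∫⁻ z, F ((z.2 : ℝ) • (z.1 : E))
          ∂μ.toSphere.prod (.volumeIoiPow (Module.finrank ℝ E - 1)) := by
      rw [← μ.measurePreserving_homeomorphUnitSphereProd.lintegral_comp hsymm]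
      refine lintegral_congr fun x => ?_
      have hx : ‖(x : E)‖ ≠ 0 := norm_ne_zero_iff.2 x.2
      simp [smul_smul, hx]
    _ = _ := by
      rw [lintegral_prod _ hsymm.aemeasurable]
      refine lintegral_congr fun ω => ?_
      have hω : Measurable fun r : ℝ => F (r • (ω : E)) := hF.comp (by fun_prop)
      rw [Measure.volumeIoiPow, ← lintegral_subtype_comap measurableSet_Ioi]
      exact lintegral_withDensity_eq_lintegral_mul _ (by fun_prop)
        (hω.comp measurable_subtype_coe)

/-- A uniform lower bound for the radial integrals of a nonnegative function bounds its
integral from below. -/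
theorem mul_toSphere_le_integral {E : Type*} [NormedAddCommGroup E] [NormedSpace ℝ E]
    [MeasurableSpace E] [BorelSpace E] [FiniteDimensional ℝ E] [Nontrivial E]
    (μ : Measure E) [μ.IsAddHaarMeasure] {H : E → ℝ} (hH : Continuous H) (hH0 : ∀ x, 0 ≤ H x)
    (hint : Integrable H μ) {c : ℝ} (hc : 0 ≤ c)
    (hrad : ∀ ω : E, ‖ω‖ = 1 → c ≤ ∫ r in (0 : ℝ)..1, r ^ (Module.finrank ℝ E - 1) * H (r • ω)) :
    c * μ.toSphere.real Set.univ ≤ ∫ x, H x ∂μ := by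
  rw [← ENNReal.ofReal_le_ofReal_iff (integral_nonneg hH0),
    ofReal_integral_eq_lintegral_ofReal hint (.of_forall hH0),
    lintegral_eq_lintegral_toSphere μ hH.measurable.ennreal_ofReal, ENNReal.ofReal_mul hc,
    Measure.real, ENNReal.ofReal_toReal (measure_ne_top _ _), ← lintegral_const]
  refine lintegral_mono fun ω => ?_
  have hω : Continuous fun r : ℝ => r ^ (Module.finrank ℝ E - 1) * H (r • (ω : E)) := by fun_prop
  have hIoc : ∫⁻ r in Set.Ioc (0 : ℝ) 1,
      ENNReal.ofReal (r ^ (Module.finrank ℝ E - 1)) * ENNReal.ofReal (H (r • (ω : E))) ≤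
      ∫⁻ r in Set.Ioi (0 : ℝ),
      ENNReal.ofReal (r ^ (Module.finrank ℝ E - 1)) * ENNReal.ofReal (H (r • (ω : E))) :=
    lintegral_mono_set Set.Ioc_subset_Ioi_self
  refine le_trans (ENNReal.ofReal_le_ofReal (hrad ω (by simp))) (le_trans (le_of_eq ?_) hIoc)
  rw [intervalIntegral.integral_of_le zero_le_one, ofReal_integral_eq_lintegral_ofReal
    (hω.integrableOn_Icc.mono_set Set.Ioc_subset_Icc_self)]
  · refine setLIntegral_congr_fun measurableSet_Ioc fun r hr => ?_
    rw [ENNReal.ofReal_mul (pow_nonneg hr.1.le _)]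
  · filter_upwards [ae_restrict_mem measurableSet_Ioc] with r hr
    exact mul_nonneg (pow_nonneg hr.1.le _) (hH0 _)

/-- The Cauchy–Schwarz inequality on the unit interval. -/
theorem sq_integral_le_integral_sq {h : ℝ → ℝ} (hh : Continuous h) :
    (∫ r in (0 : ℝ)..1, h r) ^ 2 ≤ ∫ r in (0 : ℝ)..1, h r ^ 2 := by
  set c := ∫ r in (0 : ℝ)..1, h r with hc
  have h0 : 0 ≤ ∫ r in (0 : ℝ)..1, (h r - c) ^ 2 :=
    intervalIntegral.integral_nonneg zero_le_one fun r _ => sq_nonneg _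
  have h1 : ∫ r in (0 : ℝ)..1, (h r - c) ^ 2 =
      (∫ r in (0 : ℝ)..1, h r ^ 2) - (2 * c) * c + c ^ 2 := by
    calc
      _ = ∫ r in (0 : ℝ)..1, (h r ^ 2 - (2 * c) * h r + c ^ 2) := by
        congr 1
        ext r
        ring
      _ = _ := by
        rw [intervalIntegral.integral_add, intervalIntegral.integral_sub,
          intervalIntegral.integral_const_mul, ← hc]
        · simp
        all_goals
          apply Continuous.intervalIntegrable
          fun_prop
  linarith

/-- A weighted one-dimensional Sobolev inequality: the value at the origin is controlled by
`L²` norms with weight `r²` of the function and its first two derivatives. -/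
theorem sq_apply_zero_le {φ φ' φ'' M : ℝ → ℝ} (h1 : ∀ r, HasDerivAt φ (φ' r) r)
    (h2 : ∀ r, HasDerivAt φ' (φ'' r) r) (hc : Continuous φ'') (hM : Continuous M)
    (hle : ∀ r ∈ Set.Icc (0 : ℝ) 1, 2 * |φ r| + 4 * |φ' r| + |φ'' r| ≤ M r) :
    φ 0 ^ 2 ≤ ∫ r in (0 : ℝ)..1, r ^ 2 * M r ^ 2 := by
  have c0 : Continuous φ := continuous_iff_continuousAt.2 fun r => (h1 r).continuousAt
  have c1 : Continuous φ' := continuous_iff_continuousAt.2 fun r => (h2 r).continuousAt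
  set h : ℝ → ℝ := fun r => r * (2 * φ r - 4 * (1 - r) * φ' r + (1 - r) ^ 2 * φ'' r) with hh
  have ch : Continuous h := by fun_prop
  have hint : ∫ r in (0 : ℝ)..1, h r = φ 0 := by
    have hd : ∀ r, HasDerivAt (fun r => r * ((1 - r) ^ 2 * φ' r - 2 * (1 - r) * φ r)
        - (1 - r) ^ 2 * φ r) (h r) r := by
      intro r
      have e1 : HasDerivAt (fun r : ℝ => 1 - r) (-1) r := (hasDerivAt_id r).const_sub 1
      have e2 := e1.fun_pow 2
      have e3 := ((hasDerivAt_id' r).fun_mul ((e2.fun_mul (h2 r)).fun_sub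
        ((e1.const_mul 2).fun_mul (h1 r)))).fun_sub (e2.fun_mul (h1 r))
      refine e3.congr_deriv ?_
      simp only [hh]
      push_cast
      ring
    rw [intervalIntegral.integral_eq_sub_of_hasDerivAt (fun r _ => hd r)
      (ch.intervalIntegrable _ _)]
    ring
  rw [← hint]
  refine (sq_integral_le_integral_sq ch).trans ?_
  refine intervalIntegral.integral_mono_on zero_le_one
    ((ch.pow 2).intervalIntegrable _ _) (Continuous.intervalIntegrable (by fun_prop) _ _) ?_
  intro r hr
  rw [← mul_pow]
  refine sq_le_sq' ?_ ?_ <;> simp only [hh]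
  all_goals
    have hr0 := hr.1
    have hr1 : 0 ≤ 1 - r := sub_nonneg.2 hr.2
    have b1 : |(1 - r) * φ' r| ≤ |φ' r| := by
      rw [abs_mul, abs_of_nonneg hr1]
      exact mul_le_of_le_one_left (abs_nonneg _) (by linarith)
    have b2 : |(1 - r) ^ 2 * φ'' r| ≤ |φ'' r| := by
      rw [abs_mul, abs_of_nonneg (sq_nonneg _)]
      exact mul_le_of_le_one_left (abs_nonneg _) (by nlinarith)
    have b0 := hle r hr
    have n0 := abs_le.1 (le_refl |φ r|)
    have n1 := abs_le.1 b1
    have n2 := abs_le.1 b2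
  · rw [← mul_neg]
    exact mul_le_mul_of_nonneg_left (by linarith [n0.1, n1.2, n2.1]) hr0
  · exact mul_le_mul_of_nonneg_left (by linarith [n0.2, n1.1, n2.2]) hr0

theorem contDiff_boost {m n : ℕ∞} (hmn : m + 1 ≤ n) {f : ℝ × E3 → ℝ} (hf : ContDiff ℝ n f)
    (i : Fin 3) : ContDiff ℝ m (boost i f) := by
  have hd : ContDiff ℝ m (fderiv ℝ f) := hf.fderiv_right (by exact_mod_cast hmn)
  have hx : ContDiff ℝ m fun p : ℝ × E3 => p.2 i := by fun_prop
  exact (contDiff_fst.mul (hd.clm_apply contDiff_const)).add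
    (hx.mul (hd.clm_apply contDiff_const))

theorem support_boost_subset {f : ℝ × E3 → ℝ} {R : Set (ℝ × E3)} (hR : IsClosed R)
    (hf : Function.support f ⊆ R) (i : Fin 3) : Function.support (boost i f) ⊆ R := by
  have hts : tsupport f ⊆ R := closure_minimal hf hR
  intro p hp
  by_contra hpR
  have h0 : fderiv ℝ f p = 0 := by
    by_contra hne
    exact hpR (hts (support_fderiv_subset ℝ hne))
  exact hp (by simp [boost, dx, dt, h0])

theorem continuous_hLift (ρ : ℝ) : Continuous (hLift ρ) := by
  unfold hLift
  fun_prop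

theorem hLift_fst_pos {ρ : ℝ} (hρ : 0 < ρ) (x : E3) : 0 < (hLift ρ x).1 :=
  Real.sqrt_pos.2 (by positivity)

theorem hLift_fst_sq (ρ : ℝ) (x : E3) : (hLift ρ x).1 ^ 2 = ρ ^ 2 + ‖x‖ ^ 2 :=
  Real.sq_sqrt (by positivity)

theorem norm_le_hLift_fst (ρ : ℝ) (x : E3) : ‖x‖ ≤ (hLift ρ x).1 :=
  Real.le_sqrt_of_sq_le (by nlinarith [sq_nonneg ρ])

/-- The time coordinate on the hyperboloid is a `1`-Lipschitz function of the position. -/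
theorem hLift_fst_le_add (ρ : ℝ) (x y : E3) : (hLift ρ x).1 ≤ (hLift ρ y).1 + ‖x - y‖ := by
  have h0 : 0 ≤ (hLift ρ y).1 := Real.sqrt_nonneg _
  refine Real.sqrt_le_iff.2 ⟨by positivity, ?_⟩
  have h1 := hLift_fst_sq ρ y
  have h2 := norm_le_hLift_fst ρ y
  have h3 : ‖x‖ ≤ ‖y‖ + ‖x - y‖ := norm_le_norm_add_norm_sub' x y
  nlinarith [norm_nonneg x, norm_nonneg y, norm_nonneg (x - y),
    mul_le_mul_of_nonneg_right h2 (norm_nonneg (x - y))]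

theorem hasCompactSupport_comp_hLift {ρ : ℝ} {g : ℝ × E3 → ℝ}
    (hg : Function.support g ⊆ {p : ℝ × E3 | ‖p.2‖ ≤ p.1 - 1}) :
    HasCompactSupport fun x => g (hLift ρ x) := by
  refine HasCompactSupport.intro (isCompact_closedBall (0 : E3) (ρ ^ 2)) fun x hx => ?_
  by_contra hne
  have h1 := hg (Function.mem_support.2 hne)
  have h2 := hLift_fst_sq ρ x
  rw [Set.mem_ofPred_eq, show (hLift ρ x).2 = x from rfl, le_sub_iff_add_le] at h1
  have h3 := pow_le_pow_left₀ (by positivity) h1 2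
  refine hx (mem_closedBall_zero_iff.2 ?_)
  linarith [norm_nonneg x, add_sq ‖x‖ 1]

theorem integrable_sq_comp_hLift {ρ : ℝ} {g : ℝ × E3 → ℝ} (hc : Continuous g)
    (hg : Function.support g ⊆ {p : ℝ × E3 | ‖p.2‖ ≤ p.1 - 1}) :
    Integrable fun x => g (hLift ρ x) ^ 2 := by
  refine Continuous.integrable_of_hasCompactSupport
    ((hc.comp (continuous_hLift ρ)).pow 2) ?_
  exact (hasCompactSupport_comp_hLift hg).comp_left (g := fun y : ℝ => y ^ 2) (by simp)

theorem sq_L2H (ρ : ℝ) (g : ℝ × E3 → ℝ) : L2H ρ g ^ 2 = ∫ x : E3, g (hLift ρ x) ^ 2 :=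
  Real.sq_sqrt (integral_nonneg fun _ => sq_nonneg _)

theorem hasDerivAt_hLift_fst {ρ : ℝ} (hρ : 0 < ρ) (x v : E3) (s : ℝ) :
    HasDerivAt (fun s : ℝ => (hLift ρ (x + s • v)).1)
      (((hLift ρ (x + s • v)).1)⁻¹ * inner ℝ (x + s • v) v) s := by
  have hl : HasDerivAt (fun s : ℝ => x + s • v) v s := by
    simpa using ((hasDerivAt_id s).smul_const v).const_add x
  have hq := (hl.norm_sq.const_add (ρ ^ 2)).sqrt (by positivity)
  refine hq.congr_deriv ?_
  have := hLift_fst_pos hρ (x + s • v)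
  simp only [hLift] at this ⊢
  field_simp

/-- Along the hyperboloid, directional derivatives are combinations of boosts. -/
theorem hasDerivAt_comp_hLift {ρ : ℝ} (hρ : 0 < ρ) {h : ℝ × E3 → ℝ} (hh : Differentiable ℝ h)
    (x v : E3) (s : ℝ) :
    HasDerivAt (fun s : ℝ => h (hLift ρ (x + s • v)))
      (((hLift ρ (x + s • v)).1)⁻¹ * ∑ i, v i * boost i h (hLift ρ (x + s • v))) s := by
  have hl : HasDerivAt (fun s : ℝ => x + s • v) v s := by
    simpa using ((hasDerivAt_id s).smul_const v).const_add x
  have hp := (hasDerivAt_hLift_fst hρ x v s).prodMk hl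
  have hd := (hh (hLift ρ (x + s • v))).hasFDerivAt.comp_hasDerivAt s hp
  refine hd.congr_deriv ?_
  have hτ := hLift_fst_pos hρ (x + s • v)
  set y := x + s • v
  set P := hLift ρ y with hP
  have hv : ((P.1)⁻¹ * inner ℝ y v, v) =
      ((P.1)⁻¹ * inner ℝ y v) • ((1, 0) : ℝ × E3) +
        ∑ i, v i • ((0, EuclideanSpace.single i 1) : ℝ × E3) := by
    ext i
    · simp [Fin.sum_univ_three]
    · fin_cases i <;> simp [Fin.sum_univ_three]
  have hPy : P.2 = y := rfl
  rw [hv, map_add, map_smul, map_sum]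
  simp only [map_smul, smul_eq_mul, boost, dx, dt, hPy, PiLp.inner_apply, Fin.sum_univ_three,
    RCLike.inner_apply, conj_trivial]
  field_simp
  ring

/-- The quadratic density controlling the pointwise value of `f`. -/
def boostDensity (f : ℝ × E3 → ℝ) (p : ℝ × E3) : ℝ :=
  f p ^ 2 + (∑ i : Fin 3, boost i f p ^ 2) + ∑ i : Fin 3, ∑ j : Fin 3, boost i (boost j f) p ^ 2

theorem sq_le_boostDensity (f : ℝ × E3 → ℝ) (p : ℝ × E3) :
    (|f p| + (∑ i : Fin 3, |boost i f p|) + ∑ i : Fin 3, ∑ j : Fin 3, |boost i (boost j f) p|) ^ 2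
      ≤ 13 * boostDensity f p := by
  have h := sq_sum_le_card_mul_sum_sq (s := (Finset.univ : Finset (Unit ⊕ Fin 3 ⊕ Fin 3 × Fin 3)))
    (f := Sum.elim (fun _ => |f p|) (Sum.elim (fun i => |boost i f p|)
      fun q => |boost q.1 (boost q.2 f) p|))
  simp [Fintype.sum_sum_type, Fintype.sum_prod_type] at h
  unfold boostDensity
  linarith

theorem continuous_boostDensity {f : ℝ × E3 → ℝ} (hf : ContDiff ℝ 2 f) :
    Continuous (boostDensity f) := by
  have hf1 : ∀ i, ContDiff ℝ 1 (boost i f) := fun i =>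
    contDiff_boost (m := 1) (n := 2) (by norm_num) hf i
  have c2 : ∀ i j, Continuous (boost i (boost j f)) := fun i j =>
    (contDiff_boost (m := 0) (n := 1) (by norm_num) (hf1 j) i).continuous
  have c0 := hf.continuous
  have c1 := fun i => (hf1 i).continuous
  unfold boostDensity
  fun_prop

theorem abs_inv_mul_sum_le {τ : ℝ} (hτ : 0 < τ) {v : E3} (hv : ‖v‖ ≤ τ) (b : Fin 3 → ℝ) :
    |τ⁻¹ * ∑ i, v i * b i| ≤ ∑ i, |b i| := by
  rw [Finset.mul_sum]
  refine (Finset.abs_sum_le_sum_abs _ _).trans (Finset.sum_le_sum fun i _ => ?_)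
  rw [← mul_assoc, abs_mul]
  refine mul_le_of_le_one_left (abs_nonneg _) ?_
  rw [abs_mul, abs_of_pos (inv_pos.2 hτ), inv_mul_le_one₀ hτ]
  exact (PiLp.norm_apply_le v i).trans hv

/-- The pointwise bound along a ray issued from the base point of a point of the hyperboloid. -/
theorem sq_le_radial_integral {ρ : ℝ} (hρ : 0 < ρ) {f : ℝ × E3 → ℝ} (hf : ContDiff ℝ 2 f)
    (x v : E3) (hv : 2 * ‖v‖ ≤ (hLift ρ x).1) :
    f (hLift ρ x) ^ 2 ≤
      325 * ∫ r in (0 : ℝ)..1, r ^ 2 * boostDensity f (hLift ρ (x + r • v)) := by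
  have hf1 : ∀ i, ContDiff ℝ 1 (boost i f) := fun i =>
    contDiff_boost (m := 1) (n := 2) (by norm_num) hf i
  have hf2 : ∀ i j, Continuous (boost i (boost j f)) := fun i j =>
    (contDiff_boost (m := 0) (n := 1) (by norm_num) (hf1 j) i).continuous
  have c0 := hf.continuous
  have c1 := fun i => (hf1 i).continuous
  have cP : Continuous fun r : ℝ => hLift ρ (x + r • v) :=
    (continuous_hLift ρ).comp (by fun_prop)
  have c0' := c0.comp cP
  have c1' := fun i => (c1 i).comp cP
  have c2' := fun i j => (hf2 i j).comp cP
  have cD := (continuous_boostDensity hf).comp cP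
  simp only [Function.comp_def] at c0' c1' c2' cD
  set P : ℝ → ℝ × E3 := fun r => hLift ρ (x + r • v) with hP
  have hpos : ∀ r, 0 < (P r).1 := fun r => hLift_fst_pos hρ _
  have hne : ∀ r, (P r).1 ≠ 0 := fun r => (hpos r).ne'
  have d0 := hasDerivAt_comp_hLift hρ (hf.differentiable (by norm_num)) x v
  have d1 := fun j => hasDerivAt_comp_hLift hρ ((hf1 j).differentiable (by norm_num)) x v
  have dτ := hasDerivAt_hLift_fst hρ x v
  have d2 := fun r : ℝ => ((dτ r).fun_inv (hne r)).fun_mul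
    (HasDerivAt.fun_sum (u := Finset.univ) fun j _ => ((d1 j r).const_mul (v j)))
  set M : ℝ → ℝ := fun r => 5 * (|f (P r)| + (∑ i : Fin 3, |boost i f (P r)|)
    + ∑ i : Fin 3, ∑ j : Fin 3, |boost i (boost j f) (P r)|) with hMdef
  have key := sq_apply_zero_le (M := M) d0 d2 ?_ ?_ ?_
  · simp only [zero_smul, add_zero] at key
    refine key.trans ?_
    rw [← intervalIntegral.integral_const_mul]
    refine intervalIntegral.integral_mono_on zero_le_one
      (Continuous.intervalIntegrable (by fun_prop) _ _)
      (Continuous.intervalIntegrable (by fun_prop) _ _) ?_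
    intro r hr
    have := mul_le_mul_of_nonneg_left (sq_le_boostDensity f (P r)) (sq_nonneg r)
    simp only [hMdef]
    nlinarith
  · have cτ : Continuous fun r => (P r).1 := continuous_fst.comp cP
    have cτi : Continuous fun r => ((P r).1)⁻¹ := cτ.inv₀ hne
    refine .add (.mul (.div (by fun_prop) (by fun_prop) fun r => pow_ne_zero 2 (hne r)) ?_) ?_
    · fun_prop
    · fun_prop
  · fun_prop
  · intro r hr
    have hτ := hpos r
    have hvτ : ‖v‖ ≤ (P r).1 := by
      have h := hLift_fst_le_add ρ x (x + r • v)
      rw [sub_add_cancel_left, norm_neg, norm_smul, Real.norm_of_nonneg hr.1] at h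
      have := mul_le_of_le_one_left (norm_nonneg v) hr.2
      simp only [hP]
      linarith
    have hI : |inner ℝ (x + r • v) v| ≤ (P r).1 ^ 2 := by
      rw [sq]
      exact (abs_real_inner_le_norm _ _).trans
        (mul_le_mul (norm_le_hLift_fst ρ _) hvτ (norm_nonneg _) hτ.le)
    have b1 := abs_inv_mul_sum_le hτ hvτ fun j => boost j f (P r)
    have b2 : |-(((P r).1)⁻¹ * inner ℝ (x + r • v) v) / (P r).1 ^ 2 *
        ∑ j, v j * boost j f (P r)| ≤ ∑ j, |boost j f (P r)| := by
      have : -(((P r).1)⁻¹ * inner ℝ (x + r • v) v) / (P r).1 ^ 2 * ∑ j, v j * boost j f (P r) =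
          (-inner ℝ (x + r • v) v / (P r).1 ^ 2) *
            (((P r).1)⁻¹ * ∑ j, v j * boost j f (P r)) := by ring
      rw [this, abs_mul]
      refine (mul_le_of_le_one_left (abs_nonneg _) ?_).trans b1
      rw [abs_div, abs_neg, abs_of_pos (pow_pos hτ 2)]
      exact div_le_one_of_le₀ hI (sq_nonneg _)
    have b3 : |((P r).1)⁻¹ * ∑ j, v j * (((P r).1)⁻¹ *
        ∑ i, v i * boost i (boost j f) (P r))| ≤ ∑ i, ∑ j, |boost i (boost j f) (P r)| := by
      refine (abs_inv_mul_sum_le hτ hvτ _).trans ?_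
      rw [Finset.sum_comm]
      exact Finset.sum_le_sum fun j _ => abs_inv_mul_sum_le hτ hvτ _
    refine (add_le_add le_rfl ((abs_add_le _ _).trans (add_le_add b2 b3))).trans ?_
    simp only [hMdef]
    have n0 := abs_nonneg (f (P r))
    have n2 : 0 ≤ ∑ i, ∑ j, |boost i (boost j f) (P r)| := by positivity
    linarith

/-- The `L²` norm of the density is bounded by the sum of the `L²` norms of its terms. -/
theorem integral_boostDensity_le (ρ : ℝ) {f : ℝ × E3 → ℝ} (hf : ContDiff ℝ 2 f)
    (hsupp : Function.support f ⊆ {p : ℝ × E3 | ‖p.2‖ ≤ p.1 - 1}) :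
    Integrable (fun x => boostDensity f (hLift ρ x)) ∧
    ∫ x, boostDensity f (hLift ρ x) ≤ (L2H ρ f + (∑ i : Fin 3, L2H ρ (boost i f))
      + ∑ i : Fin 3, ∑ j : Fin 3, L2H ρ (boost i (boost j f))) ^ 2 := by
  have hf1 : ∀ i, ContDiff ℝ 1 (boost i f) := fun i =>
    contDiff_boost (m := 1) (n := 2) (by norm_num) hf i
  have c2 : ∀ i j, Continuous (boost i (boost j f)) := fun i j =>
    (contDiff_boost (m := 0) (n := 1) (by norm_num) (hf1 j) i).continuous
  have hR : IsClosed {p : ℝ × E3 | ‖p.2‖ ≤ p.1 - 1} :=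
    isClosed_le (by fun_prop) (by fun_prop)
  have s1 := fun i => support_boost_subset hR hsupp i
  have i0 := integrable_sq_comp_hLift (ρ := ρ) hf.continuous hsupp
  have i1 := fun i => integrable_sq_comp_hLift (ρ := ρ) (hf1 i).continuous (s1 i)
  have i2 := fun i j => integrable_sq_comp_hLift (ρ := ρ) (c2 i j)
    (support_boost_subset hR (s1 j) i)
  have I1 := integrable_finsetSum Finset.univ fun i _ => i1 i
  have I2' := fun i => integrable_finsetSum Finset.univ fun j _ => i2 i j
  have I2 := integrable_finsetSum Finset.univ fun i _ => I2' i
  have I01 : Integrable fun x => f (hLift ρ x) ^ 2 + ∑ i, boost i f (hLift ρ x) ^ 2 :=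
    i0.add I1
  refine ⟨I01.add I2, ?_⟩
  have hsum : ∫ x, boostDensity f (hLift ρ x) = L2H ρ f ^ 2 + (∑ i : Fin 3, L2H ρ (boost i f) ^ 2)
      + ∑ i : Fin 3, ∑ j : Fin 3, L2H ρ (boost i (boost j f)) ^ 2 := by
    simp only [sq_L2H, boostDensity]
    rw [integral_add I01 I2, integral_add i0 I1, integral_finsetSum _ fun i _ => i1 i,
      integral_finsetSum _ fun i _ => I2' i]
    simp_rw [integral_finsetSum _ fun j _ => i2 _ j]
  have hn : ∀ g, 0 ≤ L2H ρ g := fun g => Real.sqrt_nonneg _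
  have h := Finset.sum_sq_le_sq_sum_of_nonneg (s := (Finset.univ : Finset (Unit ⊕ Fin 3 ⊕ Fin 3 × Fin 3)))
    (f := Sum.elim (fun _ => L2H ρ f) (Sum.elim (fun i => L2H ρ (boost i f))
      fun q => L2H ρ (boost q.1 (boost q.2 f))))
    (by rintro (_ | _ | _) _ <;> exact hn _)
  simp only [Fintype.sum_sum_type, Fintype.sum_prod_type, Sum.elim_inl, Sum.elim_inr,
    Finset.univ_unique, Finset.sum_singleton, ← add_assoc] at h
  rw [hsum]
  exact h

/-- The squared form of the Klainerman–Sobolev inequality, with an explicit constant. -/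
theorem pow_three_mul_sq_le {ρ : ℝ} (hρ : 0 < ρ) {f : ℝ × E3 → ℝ} (hf : ContDiff ℝ 2 f)
    (hsupp : Function.support f ⊆ {p : ℝ × E3 | ‖p.2‖ ≤ p.1 - 1}) (x : E3) :
    (hLift ρ x).1 ^ 3 * f (hLift ρ x) ^ 2 * (volume : Measure E3).toSphere.real Set.univ ≤
      2600 * (L2H ρ f + (∑ i : Fin 3, L2H ρ (boost i f))
      + ∑ i : Fin 3, ∑ j : Fin 3, L2H ρ (boost i (boost j f))) ^ 2 := by
  obtain ⟨hint, hle⟩ := integral_boostDensity_le ρ hf hsupp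
  have hτ := hLift_fst_pos hρ x
  set τ := (hLift ρ x).1 with hτdef
  have cD : Continuous fun y => boostDensity f (hLift ρ y) :=
    (continuous_boostDensity hf).comp (continuous_hLift ρ)
  have hint' : Integrable fun y => boostDensity f (hLift ρ (x + (τ / 2) • y)) :=
    (hint.comp_add_left x).comp_smul (R := τ / 2) (by positivity)
  have hscale : ∫ y, boostDensity f (hLift ρ (x + (τ / 2) • y)) =
      ((τ / 2) ^ 3)⁻¹ * ∫ y, boostDensity f (hLift ρ y) := by
    rw [Measure.integral_comp_smul_of_nonneg volume
      (fun y => boostDensity f (hLift ρ (x + y))) (τ / 2) (hR := by positivity),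
      integral_add_left_eq_self (fun y => boostDensity f (hLift ρ y)) x]
    simp
  have key := mul_toSphere_le_integral volume
    (H := fun y => boostDensity f (hLift ρ (x + (τ / 2) • y))) (c := f (hLift ρ x) ^ 2 / 325)
    (cD.comp (by fun_prop)) (fun y => by unfold boostDensity; positivity) hint'
    (by positivity) ?_
  · rw [hscale, inv_mul_eq_div, le_div_iff₀ (by positivity)] at key
    linarith
  · intro ω hω
    have h := sq_le_radial_integral hρ hf x ((τ / 2) • ω) (by
      rw [norm_smul, hω, Real.norm_of_nonneg (by positivity)]
      linarith)
    simp only [finrank_euclideanSpace, Fintype.card_fin, smul_comm (τ / 2), Nat.add_one_sub_one]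
    linarith

/-- Klainerman–Sobolev inequality on hyperboloids: for `f` supported in `{|x| ≤ t − 1}`,
`sup_{H_ρ} t^{3/2} |f| ≤ C Σ_{|J| ≤ 2} ‖L^J f‖_{L²(H_ρ)}`, where `L^J` ranges over
compositions of at most two boosts. -/
theorem klainerman_sobolev_on_hyperboloids :
    ∃ C > (0 : ℝ), ∀ ρ : ℝ, 0 < ρ → ∀ f : ℝ × E3 → ℝ, ContDiff ℝ 2 f →
      (Function.support f ⊆ {p : ℝ × E3 | ‖p.2‖ ≤ p.1 - 1}) →
      ∀ p ∈ Hyp ρ, p.1 ^ ((3 : ℝ) / 2) * |f p| ≤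
        C * (L2H ρ f + (∑ i : Fin 3, L2H ρ (boost i f))
          + ∑ i : Fin 3, ∑ j : Fin 3, L2H ρ (boost i (boost j f))) := by
  have hσ : 0 < (volume : Measure E3).toSphere.real Set.univ := by
    rw [Measure.toSphere_real_apply_univ, finrank_euclideanSpace]
    have : 0 < (volume : Measure E3).real (Metric.ball 0 1) :=
      ENNReal.toReal_pos (Metric.measure_ball_pos _ _ one_pos).ne' measure_ball_lt_top.ne
    simp only [Fintype.card_fin]
    positivity
  set σ := (volume : Measure E3).toSphere.real Set.univ
  refine ⟨Real.sqrt (2600 / σ), by positivity, fun ρ hρ f hf hsupp p hp => ?_⟩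
  have hpx : p = hLift ρ p.2 := by
    refine Prod.ext ?_ rfl
    have : ρ ^ 2 + ‖p.2‖ ^ 2 = p.1 ^ 2 := by linarith [hp.2]
    simp only [hLift, this, Real.sqrt_sq hp.1.le]
  have key := pow_three_mul_sq_le hρ hf hsupp p.2
  rw [← hpx] at key
  have hS : 0 ≤ L2H ρ f + (∑ i : Fin 3, L2H ρ (boost i f))
      + ∑ i : Fin 3, ∑ j : Fin 3, L2H ρ (boost i (boost j f)) := by
    unfold L2H
    positivity
  have hp1 := hp.1
  refine le_of_sq_le_sq ?_ (by positivity)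
  have h3 : (p.1 ^ ((3 : ℝ) / 2)) ^ 2 = p.1 ^ 3 := by
    rw [← Real.rpow_natCast, ← Real.rpow_natCast, ← Real.rpow_mul hp1.le]
    norm_num
  rw [mul_pow, mul_pow, h3, sq_abs, Real.sq_sqrt (by positivity), div_mul_eq_mul_div,
    le_div_iff₀ hσ]
  exact key
end
end

section
/- Interior decay for the wave equation with a t^{−3+a} source supported in the light cone: Let 0 ≤ a < 1/2 and ε > 0. There is a constant C = C(a) such that the following holds. Let F : [2,∞) × ℝ³ → ℝ be continuous with F(t,x) = 0 whenever |x| ≥ t, and |F(t,x)| ≤ ε t^{−3+a} for all t ≥ 2. Define u by the Duhamel/Kirchhoff formula u(t,x) = (1/4π) ∫_2^t (t − s)^{−1} ∫_{{z : |z − x| = t − s}} F(s, z) dσ(z) ds. Then for all t ≥ 2 and all x with |x| < t, |u(t,x)| ≤ C ε t^{−1+a} (1 − |x|/t)^a = C ε t^{−1} (t − |x|)^a. -/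
noncomputable section

open Real MeasureTheory Metric

/-- The standard surface measure on the unit sphere `S² ⊂ ℝ³`. -/
def sphereMeasure : Measure (sphere (0 : E3) 1) := volume.toSphere

/-- The integral of `F` over the sphere of center `x` and radius `R` with respect to
surface measure: `∫_{|z−x|=R} F(z) dσ(z) = R² ∫_{S²} F(x + Rω) dσ(ω)`. -/
def sphereIntegral (F : E3 → ℝ) (x : E3) (R : ℝ) : ℝ :=
  R ^ 2 * ∫ ω : sphere (0 : E3) 1, F (x + R • (ω : E3)) ∂sphereMeasure

/-- The forward solution of `∂_t²u − Δu = F` with vanishing data at `t = 2`, given by the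
Duhamel/Kirchhoff formula `u(t,x) = (1/4π) ∫_2^t (t−s)⁻¹ ∫_{|z−x|=t−s} F(s,z) dσ(z) ds`. -/
def duhamel (F : ℝ × E3 → ℝ) (t : ℝ) (x : E3) : ℝ :=
  (1 / (4 * π)) * ∫ s in Set.Ioo (2 : ℝ) t,
    (t - s)⁻¹ * sphereIntegral (fun z => F (s, z)) x (t - s)

open Set Pointwise in
/-- A spherical cap of height `h` in the unit sphere of `ℝ³` has area `O(h)`. -/
theorem sphereMeasure_cap_le (e : E3) (he : ‖e‖ = 1) (h : ℝ) (hh : 0 ≤ h) :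
    sphereMeasure.real {ω : sphere (0 : E3) 1 | inner ℝ e (ω : E3) ≤ -1 + h} ≤ 48 * h := by
  have hmeas : MeasurableSet {ω : sphere (0 : E3) 1 | inner ℝ e (ω : E3) ≤ -1 + h} :=
    (isClosed_le (by fun_prop) continuous_const).measurableSet
  obtain ⟨b, hb⟩ := Orthonormal.exists_orthonormalBasis_extension_of_card_eq (𝕜 := ℝ) (E := E3)
    (ι := Fin 3) (by simp) (v := fun _ => e) (s := {0})
    (by
      refine ⟨fun _ => by simpa using he, fun i j hij => ?_⟩
      exact absurd (Subsingleton.elim i j) hij)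
  have hb0 : b 0 = e := hb 0 rfl
  set q : ℝ := √(2 * h) with hq
  let box : Set (Fin 3 → ℝ) := Icc ![-1, -q, -q] ![1, q, q]
  let T : E3 → (Fin 3 → ℝ) := fun y => (b.repr y).ofLp
  have hT : MeasurePreserving T volume volume :=
    (PiLp.volume_preserving_ofLp (Fin 3)).comp b.measurePreserving_repr
  have hsub : (Ioo (0 : ℝ) 1 • (Subtype.val '' {ω : sphere (0 : E3) 1 |
      inner ℝ e (ω : E3) ≤ -1 + h}) : Set E3) ⊆ T ⁻¹' box := by
    rintro _ ⟨ρ, ⟨hρ0, hρ1⟩, _, ⟨ω, hω, rfl⟩, rfl⟩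
    simp only [mem_ofPred_eq] at hω
    have hnorm : ‖(ω : E3)‖ = 1 := by simp
    have hsum : (b.repr ω) 0 ^ 2 + (b.repr ω) 1 ^ 2 + (b.repr ω) 2 ^ 2 = 1 := by
      have h1 : ‖b.repr ω‖ ^ 2 = 1 := by rw [LinearIsometryEquiv.norm_map, hnorm]; norm_num
      rw [EuclideanSpace.norm_sq_eq, Fin.sum_univ_three] at h1
      simpa [Real.norm_eq_abs, sq_abs] using h1
    have h0 : (b.repr ω) 0 ≤ -1 + h := by
      rw [OrthonormalBasis.repr_apply_apply, hb0]; exact hω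
    set w0 := (b.repr ω) 0
    set w1 := (b.repr ω) 1
    set w2 := (b.repr ω) 2
    have hperp : w1 ^ 2 + w2 ^ 2 ≤ 2 * h := by
      have : -1 ≤ w0 := by nlinarith [sq_nonneg w1, sq_nonneg w2]
      rcases le_total h 1 with h1 | h1
      · nlinarith
      · nlinarith [sq_nonneg w0]
    have hw0 : |w0| ≤ 1 :=
      abs_le_one_iff_mul_self_le_one.2 (by nlinarith [sq_nonneg w1, sq_nonneg w2])
    have hw1 : |w1| ≤ q := Real.abs_le_sqrt (by nlinarith [sq_nonneg w2])
    have hw2 : |w2| ≤ q := Real.abs_le_sqrt (by nlinarith [sq_nonneg w1])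
    have key : ∀ w c : ℝ, |w| ≤ c → |ρ * w| ≤ c := fun w c hw => by
      rw [abs_mul, abs_of_pos hρ0]
      nlinarith [abs_nonneg w]
    have k0 := abs_le.1 (key _ _ hw0)
    have k1 := abs_le.1 (key _ _ hw1)
    have k2 := abs_le.1 (key _ _ hw2)
    have hTi : ∀ i, T (ρ • (ω : E3)) i = ρ * (b.repr ω) i := fun i => by
      simp [T]
    refine ⟨fun i => ?_, fun i => ?_⟩ <;> fin_cases i <;>
      simp only [hTi]
    exacts [k0.1, k1.1, k2.1, k0.2, k1.2, k2.2]
  have hvol : volume box = ENNReal.ofReal (16 * h) := by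
    have hq0 : 0 ≤ q := Real.sqrt_nonneg _
    have hqq : q * q = 2 * h := Real.mul_self_sqrt (by linarith)
    rw [Real.volume_Icc_pi, Fin.prod_univ_three]
    simp only [Matrix.cons_val_zero, Matrix.cons_val_one, Matrix.cons_val]
    rw [← ENNReal.ofReal_mul (by norm_num),
      ← ENNReal.ofReal_mul (mul_nonneg (by norm_num) (by linarith))]
    congr 1
    linear_combination 8 * hqq
  have hle : volume (Ioo (0 : ℝ) 1 • (Subtype.val '' {ω : sphere (0 : E3) 1 |
      inner ℝ e (ω : E3) ≤ -1 + h}) : Set E3) ≤ ENNReal.ofReal (16 * h) :=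
    (measure_mono hsub).trans
      (by rw [hT.measure_preimage measurableSet_Icc.nullMeasurableSet, hvol])
  rw [measureReal_def, sphereMeasure, Measure.toSphere_apply' _ hmeas]
  simp only [finrank_euclideanSpace, Fintype.card_fin, ENNReal.toReal_mul]
  have := ENNReal.toReal_mono ENNReal.ofReal_ne_top hle
  rw [ENNReal.toReal_ofReal (by linarith)] at this
  rw [show ENNReal.toReal ((3 : ℕ) : ENNReal) = 3 by norm_num]
  linarith

instance : IsFiniteMeasure sphereMeasure := by
  unfold sphereMeasure
  infer_instance

theorem abs_sphereIntegral_le {F : E3 → ℝ} {x : E3} {R M : ℝ} (S : Set (sphere (0 : E3) 1))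
    (hM : ∀ ω ∈ S, |F (x + R • (ω : E3))| ≤ M)
    (h0 : ∀ ω ∉ S, F (x + R • (ω : E3)) = 0) :
    |sphereIntegral F x R| ≤ R ^ 2 * (M * sphereMeasure.real S) := by
  rw [sphereIntegral, abs_mul, abs_of_nonneg (sq_nonneg R),
    ← setIntegral_eq_integral_of_forall_compl_eq_zero h0]
  have hint := norm_setIntegral_le_of_norm_le_const (μ := sphereMeasure)
    (f := fun ω : sphere (0 : E3) 1 => F (x + R • (ω : E3)))
    (measure_lt_top _ S) hM
  exact mul_le_mul_of_nonneg_left hint (sq_nonneg R)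

/-- If `F` is supported in the ball of radius `s` about the origin, where `s + R > ‖x‖`, then only
a small cap of the sphere of center `x` and radius `R` contributes to the integral of `F`. -/
theorem abs_sphereIntegral_le_of_support {F : E3 → ℝ} {x : E3} {R s M : ℝ} (hx : 0 < ‖x‖)
    (hR : 0 < R) (hs : 0 ≤ s) (hxs : ‖x‖ ≤ s + R) (hF : ∀ z, s ≤ ‖z‖ → F z = 0)
    (hM : ∀ z, |F z| ≤ M) :
    |sphereIntegral F x R| ≤ R * (48 * M * (s + R - ‖x‖) * s / ‖x‖) := by
  have hM0 : 0 ≤ M := (abs_nonneg _).trans (hM 0)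
  have hd : 0 ≤ s + R - ‖x‖ := by linarith
  set h : ℝ := (s + R - ‖x‖) * s / (‖x‖ * R) with hh
  have hh0 : 0 ≤ h := by positivity
  set e : E3 := ‖x‖⁻¹ • x with he
  have hxe : x = ‖x‖ • e := by rw [he, smul_smul, mul_inv_cancel₀ hx.ne', one_smul]
  have he1 : ‖e‖ = 1 := by
    rw [he, norm_smul, norm_inv, norm_norm, inv_mul_cancel₀ hx.ne']
  have hcap := sphereMeasure_cap_le e he1 h hh0
  refine (abs_sphereIntegral_le {ω : sphere (0 : E3) 1 | inner ℝ e (ω : E3) ≤ -1 + h}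
    (fun ω _ => hM _) fun ω hω => hF _ ?_).trans ?_
  · simp only [Set.mem_ofPred_eq, not_le] at hω
    have hnorm : ‖(ω : E3)‖ = 1 := by simp
    have hsq : ‖x + R • (ω : E3)‖ ^ 2
        = ‖x‖ ^ 2 + 2 * (‖x‖ * R) * inner ℝ e (ω : E3) + R ^ 2 := by
      rw [norm_add_sq_real, inner_smul_right, norm_smul, hnorm, Real.norm_of_nonneg hR.le]
      conv_lhs => rw [hxe, inner_smul_left, ← hxe]
      simp only [conj_trivial]
      ring
    have hRh : (‖x‖ * R) * h = (s + R - ‖x‖) * s := by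
      rw [hh]; field_simp
    have hlt := mul_lt_mul_of_pos_left hω (mul_pos hx hR)
    refine le_of_sq_le_sq ?_ (norm_nonneg _)
    rw [hsq]
    nlinarith [sq_nonneg (s + R - ‖x‖)]
  · calc R ^ 2 * (M * _) ≤ R ^ 2 * (M * (48 * h)) := by gcongr
      _ = _ := by rw [hh]; field_simp

theorem sphereIntegral_eq_zero_of_support {F : E3 → ℝ} {x : E3} {R s : ℝ} (hR : 0 ≤ R)
    (hs : s + ‖x‖ ≤ R) (hF : ∀ z, s ≤ ‖z‖ → F z = 0) : sphereIntegral F x R = 0 := by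
  have : ∀ ω : sphere (0 : E3) 1, F (x + R • (ω : E3)) = 0 := fun ω => by
    refine hF _ ?_
    have h1 : ‖R • (ω : E3)‖ = R := by
      rw [norm_smul, Real.norm_of_nonneg hR]; simp
    have h2 := norm_sub_le (x + R • (ω : E3)) x
    rw [add_sub_cancel_left, h1] at h2
    linarith
  simp [sphereIntegral, this]

section Decay

variable {a ε t : ℝ} {F : ℝ × E3 → ℝ} {x : E3}

theorem abs_duhamel_le_abs_integral (F : ℝ × E3 → ℝ) (t : ℝ) (x : E3) :
    |duhamel F t x| ≤ |∫ s in Set.Ioo (2 : ℝ) t,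
      (t - s)⁻¹ * sphereIntegral (fun z => F (s, z)) x (t - s)| := by
  rw [duhamel, abs_mul]
  refine mul_le_of_le_one_left (abs_nonneg _) ?_
  rw [abs_of_pos (by positivity), div_le_one (by positivity)]
  linarith [Real.pi_gt_three]

/-- Decay far from the light cone. -/
theorem abs_duhamel_le_of_two_mul_norm_le (ha0 : 0 ≤ a) (ha1 : a < 1 / 2) (hε : 0 < ε)
    (hsupp : ∀ (t : ℝ) (x : E3), 2 ≤ t → t ≤ ‖x‖ → F (t, x) = 0)
    (hbd : ∀ (t : ℝ) (x : E3), 2 ≤ t → |F (t, x)| ≤ ε * t ^ (-3 + a))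
    (ht : 2 ≤ t) (hx : 2 * ‖x‖ ≤ t) :
    |duhamel F t x| ≤
      128 * sphereMeasure.real Set.univ * ε * t ^ (-1 + a) * (1 - ‖x‖ / t) ^ a := by
  have ht0 : 0 < t := by linarith
  set K := sphereMeasure.real Set.univ with hK
  have hK0 : 0 ≤ K := measureReal_nonneg
  have hpt : ∀ s ∈ Set.Ioo 2 t,
      ‖(t - s)⁻¹ * sphereIntegral (fun z => F (s, z)) x (t - s)‖
        ≤ t * (ε * (64 * t ^ (-3 + a)) * K) := by
    rintro s ⟨hs2, hst⟩
    have hR : 0 < t - s := by linarith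
    rcases le_total (s + ‖x‖) (t - s) with h | h
    · rw [sphereIntegral_eq_zero_of_support hR.le h fun z hz => hsupp s z hs2.le hz]
      simp only [mul_zero, norm_zero]
      positivity
    have hs4 : t / 4 ≤ s := by linarith
    have hpow : s ^ (-3 + a) ≤ 64 * t ^ (-3 + a) := by
      calc s ^ (-3 + a) ≤ (t / 4) ^ (-3 + a) :=
            Real.rpow_le_rpow_of_nonpos (by positivity) hs4 (by linarith)
        _ = t ^ (-3 + a) * 4 ^ (3 - a) := by
            rw [Real.div_rpow ht0.le (by norm_num), div_eq_mul_inv, ← Real.rpow_neg (by norm_num)]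
            ring_nf
        _ ≤ t ^ (-3 + a) * 4 ^ (3 : ℝ) := by
            gcongr
            · norm_num
            · linarith
        _ = 64 * t ^ (-3 + a) := by norm_num; ring
    have hS := abs_sphereIntegral_le (F := fun z => F (s, z)) (x := x) (R := t - s)
      (M := ε * (64 * t ^ (-3 + a))) Set.univ
      (fun ω _ => (hbd s _ hs2.le).trans (by gcongr)) (fun ω hω => absurd (Set.mem_univ ω) hω)
    rw [Real.norm_eq_abs, abs_mul, abs_of_pos (inv_pos.2 hR)]
    calc (t - s)⁻¹ * |sphereIntegral (fun z => F (s, z)) x (t - s)|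
        ≤ (t - s)⁻¹ * ((t - s) ^ 2 * (ε * (64 * t ^ (-3 + a)) * K)) := by gcongr
      _ = (t - s) * (ε * (64 * t ^ (-3 + a)) * K) := by field_simp
      _ ≤ t * (ε * (64 * t ^ (-3 + a)) * K) := by gcongr; linarith
  have hint := norm_setIntegral_le_of_norm_le_const (μ := volume) (by simp) hpt
  have hhalf : 1 / 2 ≤ (1 - ‖x‖ / t) ^ a := by
    have h1 : 1 / 2 ≤ 1 - ‖x‖ / t := by
      have : ‖x‖ / t ≤ 1 / 2 := by rw [div_le_div_iff₀ ht0 (by norm_num)]; linarith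
      linarith
    have h2 : 1 - ‖x‖ / t ≤ 1 := by
      have : 0 ≤ ‖x‖ / t := by positivity
      linarith
    calc (1 / 2 : ℝ) ≤ 1 - ‖x‖ / t := h1
      _ = (1 - ‖x‖ / t) ^ (1 : ℝ) := (Real.rpow_one _).symm
      _ ≤ _ := Real.rpow_le_rpow_of_exponent_ge (by linarith) h2 (by linarith)
  have hpow : t ^ (-1 + a) = t * t * t ^ (-3 + a) := by
    rw [show -1 + a = (-3 + a) + 1 + 1 by ring, Real.rpow_add_one ht0.ne',
      Real.rpow_add_one ht0.ne']
    ring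
  calc |duhamel F t x| ≤ t * (ε * (64 * t ^ (-3 + a)) * K) * volume.real (Set.Ioo 2 t) :=
        (abs_duhamel_le_abs_integral F t x).trans hint
    _ ≤ t * (ε * (64 * t ^ (-3 + a)) * K) * t := by
        gcongr
        rw [Real.volume_real_Ioo_of_le ht]
        linarith
    _ = 128 * K * ε * t ^ (-1 + a) * (1 / 2) := by rw [hpow]; ring
    _ ≤ _ := by gcongr

/-- Decay near the light cone. -/
theorem abs_duhamel_le_of_le_two_mul_norm (ha0 : 0 ≤ a) (ha1 : a < 1 / 2) (hε : 0 < ε)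
    (hsupp : ∀ (t : ℝ) (x : E3), 2 ≤ t → t ≤ ‖x‖ → F (t, x) = 0)
    (hbd : ∀ (t : ℝ) (x : E3), 2 ≤ t → |F (t, x)| ≤ ε * t ^ (-3 + a))
    (ht : 2 ≤ t) (hxt : ‖x‖ < t) (hx : t ≤ 2 * ‖x‖) :
    |duhamel F t x| ≤ 384 * ε * t ^ (-1 + a) * (1 - ‖x‖ / t) ^ a := by
  have ht0 : 0 < t := by linarith
  have hx0 : 0 < ‖x‖ := by linarith
  set d := t - ‖x‖ with hd
  have hd0 : 0 < d := by linarith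
  set c := 48 * ε * d / ‖x‖ with hc
  have hc0 : 0 ≤ c := by positivity
  let g : ℝ → ℝ := (Set.Ioi (d / 2)).indicator fun s => c * s ^ (-2 + a)
  have hpowint : IntegrableOn (fun s : ℝ => c * s ^ (-2 + a)) (Set.Ioi (d / 2)) :=
    (integrableOn_Ioi_rpow_of_lt (by linarith) (by linarith)).const_mul c
  have hg : Integrable g := hpowint.integrable_indicator measurableSet_Ioi
  have hg0 : 0 ≤ g := fun s => Set.indicator_nonneg (fun s hs => by
    have : 0 < s := lt_trans (by linarith) hs
    positivity) s
  have hpt : ∀ s ∈ Set.Ioo 2 t,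
      ‖(t - s)⁻¹ * sphereIntegral (fun z => F (s, z)) x (t - s)‖ ≤ g s := by
    rintro s ⟨hs2, hst⟩
    have hR : 0 < t - s := by linarith
    have hs0 : 0 < s := by linarith
    rcases le_or_gt s (d / 2) with h | h
    · rw [sphereIntegral_eq_zero_of_support hR.le (by linarith) fun z hz => hsupp s z hs2.le hz]
      simpa using hg0 s
    have hS := abs_sphereIntegral_le_of_support (F := fun z => F (s, z)) hx0 hR hs0.le
      (by linarith) (fun z hz => hsupp s z hs2.le hz) fun z => hbd s z hs2.le
    have hgs : g s = c * s ^ (-2 + a) := Set.indicator_of_mem (s := Set.Ioi (d / 2)) h _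
    rw [hgs, Real.norm_eq_abs, abs_mul, abs_of_pos (inv_pos.2 hR), inv_mul_le_iff₀ hR]
    refine hS.trans_eq ?_
    rw [show -2 + a = (-3 + a) + 1 by ring, Real.rpow_add_one hs0.ne', hc, hd]
    ring
  have hint : |∫ s in Set.Ioo (2 : ℝ) t,
      (t - s)⁻¹ * sphereIntegral (fun z => F (s, z)) x (t - s)|
        ≤ c * ((d / 2) ^ (-1 + a) / (1 - a)) := by
    calc _ ≤ ∫ s in Set.Ioo 2 t, g s :=
          norm_integral_le_of_norm_le hg.integrableOn
            ((ae_restrict_iff' measurableSet_Ioo).2 (Filter.Eventually.of_forall hpt))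
      _ ≤ ∫ s, g s := setIntegral_le_integral hg (Filter.Eventually.of_forall hg0)
      _ = _ := by
          rw [integral_indicator measurableSet_Ioi, integral_const_mul,
            integral_Ioi_rpow_of_lt (by linarith) (by linarith),
            show -2 + a + 1 = -1 + a by ring, show (1 - a) = -(-1 + a) by ring, div_neg, neg_div]
  have hpow1 : (d / 2) ^ (-1 + a) ≤ 2 * d ^ (-1 + a) := by
    rw [Real.div_rpow hd0.le (by norm_num), div_eq_mul_inv, ← Real.rpow_neg (by norm_num),
      mul_comm]
    gcongr
    calc (2 : ℝ) ^ (-(-1 + a)) ≤ 2 ^ (1 : ℝ) := by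
          gcongr
          · norm_num
          · linarith
      _ = 2 := by norm_num
  have hpow2 : t ^ (-1 + a) * (1 - ‖x‖ / t) ^ a = d * d ^ (-1 + a) / t := by
    rw [show 1 - ‖x‖ / t = d / t by rw [hd]; field_simp, Real.div_rpow hd0.le ht0.le,
      Real.rpow_add ht0, Real.rpow_add hd0, Real.rpow_neg_one, Real.rpow_neg_one]
    have := Real.rpow_pos_of_pos ht0 a
    field_simp
  have hinv : ‖x‖⁻¹ ≤ 2 / t := by
    rw [inv_eq_one_div, div_le_div_iff₀ hx0 ht0]
    linarith
  have hdiv : (1 - a)⁻¹ ≤ 2 := inv_le_of_inv_le₀ (by norm_num) (by linarith)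
  have ha1' : 0 < 1 - a := by linarith
  calc |duhamel F t x| ≤ c * ((d / 2) ^ (-1 + a) / (1 - a)) :=
        (abs_duhamel_le_abs_integral F t x).trans hint
    _ = 48 * ε * d * ‖x‖⁻¹ * ((d / 2) ^ (-1 + a) * (1 - a)⁻¹) := by rw [hc]; ring
    _ ≤ 48 * ε * d * (2 / t) * (2 * d ^ (-1 + a) * 2) := by gcongr
    _ = 384 * ε * (d * d ^ (-1 + a) / t) := by ring
    _ = _ := by rw [← hpow2]; ring

end Decay

/-- Interior decay for the wave equation with a `t^{−3+a}` source supported in the light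
cone: if `F` vanishes for `|x| ≥ t` and `|F| ≤ ε t^{−3+a}`, then the forward solution
satisfies `|u(t,x)| ≤ C ε t^{−1+a} (1 − |x|/t)^a` for `t ≥ 2`, `|x| < t`. -/
theorem interior_decay_wave_with_decaying_source (a : ℝ) (ha0 : 0 ≤ a) (ha1 : a < 1 / 2) :
    ∃ C > (0 : ℝ), ∀ ε > (0 : ℝ), ∀ F : ℝ × E3 → ℝ,
      ContinuousOn F {p : ℝ × E3 | 2 ≤ p.1} →
      (∀ (t : ℝ) (x : E3), 2 ≤ t → t ≤ ‖x‖ → F (t, x) = 0) →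
      (∀ (t : ℝ) (x : E3), 2 ≤ t → |F (t, x)| ≤ ε * t ^ (-3 + a)) →
      ∀ (t : ℝ) (x : E3), 2 ≤ t → ‖x‖ < t →
        |duhamel F t x| ≤ C * ε * t ^ (-1 + a) * (1 - ‖x‖ / t) ^ a := by
  have hK : 0 ≤ sphereMeasure.real Set.univ := measureReal_nonneg
  refine ⟨128 * sphereMeasure.real Set.univ + 384, by positivity,
    fun ε hε F _ hsupp hbd t x ht hxt => ?_⟩
  have ht0 : 0 < t := by linarith
  have hd : 0 ≤ 1 - ‖x‖ / t := by
    rw [sub_nonneg, div_le_one ht0]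
    exact hxt.le
  rcases le_total (2 * ‖x‖) t with h | h
  · refine (abs_duhamel_le_of_two_mul_norm_le ha0 ha1 hε hsupp hbd ht h).trans ?_
    gcongr
    linarith
  · refine (abs_duhamel_le_of_le_two_mul_norm ha0 ha1 hε hsupp hbd ht hxt h).trans ?_
    gcongr
    linarith
end
end

section
/- Uniform boundedness of the interior homogeneous profile: Let δ ∈ (0, 1/2) and ε > 0. There is a constant C = C(δ) such that for every measurable P : ℝ³ → ℝ with |P(y)| ≤ ε² (1 − |y|²)^{2−2δ} for |y| < 1 and P(y) = 0 for |y| ≥ 1, the integral Ũ(y) := (1/4π) ∫_0^1 ∫_{S²} (1 − λ) λ^{−3} P((y − (1−λ)η)/λ) dσ(η) dλ converges absolutely for every y with |y| < 1, and |Ũ(y)| ≤ C ε² uniformly for |y| < 1. -/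
noncomputable section

open Real MeasureTheory Metric

/-- The integrand `(1 − λ) λ^{−3} P((y − (1−λ)η)/λ)` of the homogeneous profile. -/
def profileIntegrand (P : E3 → ℝ) (y : E3) (l : ℝ) (η : sphere (0 : E3) 1) : ℝ :=
  (1 - l) * l ^ (-3 : ℝ) * P (l⁻¹ • (y - (1 - l) • (η : E3)))

/-- The interior homogeneous profile
`Ũ(y) = (1/4π) ∫_0^1 ∫_{S²} (1 − λ) λ^{−3} P((y − (1−λ)η)/λ) dσ(η) dλ`. -/
def Utilde (P : E3 → ℝ) (y : E3) : ℝ :=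
  (1 / (4 * π)) * ∫ l in Set.Ioc (0 : ℝ) 1, ∫ η, profileIntegrand P y l η ∂sphereMeasure

open scoped Pointwise ENNReal in
/-- A spherical cap of radius `r ≤ 1` has surface measure at most a constant times `r²`. -/
lemma sphereMeasure_ball_le (w : E3) {r : ℝ} (hr : 0 < r) (hr1 : r ≤ 1) :
    sphereMeasure {η | ‖(η : E3) - w‖ < r} ≤
      ENNReal.ofReal (24 * volume.real (ball (0 : E3) 1) * r ^ 2) := by
  set s : Set (sphere (0 : E3) 1) := {η | ‖(η : E3) - w‖ < r}
  have hs : MeasurableSet s := by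
    apply measurableSet_lt <;> fun_prop
  set A : Set E3 := Set.Ioo (0 : ℝ) 1 • ((↑) '' s : Set E3)
  have hσ : sphereMeasure s = 3 * volume A := by
    rw [sphereMeasure, Measure.toSphere_apply' _ hs]
    simp [A]
  have hA : A ⊆ ball 0 1 := by
    rintro _ ⟨t, ht, _, ⟨η, -, rfl⟩, rfl⟩
    simpa [norm_smul, abs_of_pos ht.1] using ht.2
  have hAfin : volume A ≠ ∞ := ((measure_mono hA).trans_lt measure_ball_lt_top).ne
  have hdiff : A \ ((1 - r) • A) ⊆ ball w (2 * r) := by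
    rintro _ ⟨⟨t, ht, _, ⟨η, hη, rfl⟩, rfl⟩, hn⟩
    have htr : 1 - r ≤ t := by
      by_contra! h
      have h0 : 0 < 1 - r := ht.1.trans h
      refine hn ⟨(t / (1 - r)) • (η : E3), ⟨t / (1 - r), ⟨div_pos ht.1 h0, (div_lt_one h0).2 h⟩,
        _, ⟨η, hη, rfl⟩, rfl⟩, ?_⟩
      simp [smul_smul, mul_div_cancel₀ _ h0.ne']
    have hη' : ‖(η : E3) - w‖ < r := hη
    have hη1 : ‖(η : E3)‖ = 1 := by simp
    have h1 : ‖t • (η : E3) - η‖ = 1 - t := by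
      have : t • (η : E3) - η = (t - 1) • (η : E3) := by rw [sub_smul, one_smul]
      rw [this, norm_smul, hη1, mul_one, Real.norm_eq_abs, abs_of_neg (by linarith [ht.2])]
      ring
    have h2 := norm_add_le (t • (η : E3) - η) ((η : E3) - w)
    rw [sub_add_sub_cancel] at h2
    simp only [mem_ball, dist_eq_norm]
    linarith
  have hsmul : volume.real ((1 - r) • A) = (1 - r) ^ 3 * volume.real A := by
    rw [measureReal_def, Measure.addHaar_smul, ENNReal.toReal_mul,
      ENNReal.toReal_ofReal (abs_nonneg _),
      abs_of_nonneg (by simp; exact pow_nonneg (by linarith) _)]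
    simp [measureReal_def]
  have hball : volume.real (ball w (2 * r)) = (2 * r) ^ 3 * volume.real (ball (0 : E3) 1) := by
    rw [measureReal_def, Measure.addHaar_ball _ _ (by positivity), ENNReal.toReal_mul,
      ENNReal.toReal_ofReal (by positivity)]
    simp [measureReal_def]
  have hle : volume.real A - volume.real ((1 - r) • A) ≤ volume.real (ball w (2 * r)) := by
    have h1 : volume A ≤ volume (A \ ((1 - r) • A)) + volume ((1 - r) • A) := by
      refine (measure_mono ?_).trans (measure_union_le _ _)
      rw [Set.sdiff_union_self]
      exact Set.subset_union_left
    have h2 : volume A ≤ volume (ball w (2 * r)) + volume ((1 - r) • A) :=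
      h1.trans (by gcongr)
    have hfin : volume ((1 - r) • A) ≠ ∞ := by
      rw [Measure.addHaar_smul]
      exact ENNReal.mul_ne_top ENNReal.ofReal_ne_top hAfin
    have h3 := ENNReal.toReal_mono (ENNReal.add_ne_top.2 ⟨measure_ball_lt_top.ne, hfin⟩) h2
    rw [ENNReal.toReal_add measure_ball_lt_top.ne hfin] at h3
    simp only [measureReal_def]
    linarith
  rw [hsmul, hball] at hle
  have hV : 0 ≤ volume.real A := measureReal_nonneg
  have hfinal : volume.real A ≤ 8 * r ^ 2 * volume.real (ball (0 : E3) 1) := by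
    have h4 : r * volume.real A ≤ r * (8 * r ^ 2 * volume.real (ball (0 : E3) 1)) := by
      have h5 : 0 ≤ (1 - r) * (2 - r) * r * volume.real A := by
        have : 0 ≤ 1 - r := by linarith
        have : 0 ≤ 2 - r := by linarith
        positivity
      nlinarith
    exact le_of_mul_le_mul_left h4 hr
  rw [hσ, ← ENNReal.ofReal_toReal hAfin, ← ENNReal.ofReal_ofNat 3,
    ← ENNReal.ofReal_mul (by norm_num)]
  apply ENNReal.ofReal_le_ofReal
  rw [← measureReal_def]
  linarith

/-- The directions along which the backward cone meets the unit ball at scale `l` have surface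
measure `O(l²)`. -/
lemma exists_sphereMeasure_cone_le :
    ∃ K > (0 : ℝ), ∀ (y : E3) (l : ℝ), 0 < l → l ≤ 1 →
      sphereMeasure {η | ‖y - (1 - l) • (η : E3)‖ < l} ≤ ENNReal.ofReal (K * l ^ 2) := by
  set B := volume.real (ball (0 : E3) 1)
  have hB : 0 ≤ B := measureReal_nonneg
  have hS : 0 ≤ sphereMeasure.real Set.univ := measureReal_nonneg
  refine ⟨96 * B + 4 * sphereMeasure.real Set.univ + 1, by positivity, fun y l hl hl1 => ?_⟩
  rcases le_total l (1 / 2) with h | h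
  · have h0 : 0 < 1 - l := by linarith
    have hsub : {η : sphere (0 : E3) 1 | ‖y - (1 - l) • (η : E3)‖ < l} ⊆
        {η | ‖(η : E3) - (1 - l)⁻¹ • y‖ < 2 * l} := by
      intro η hη
      simp only [Set.mem_ofPred_eq] at hη ⊢
      have : (η : E3) - (1 - l)⁻¹ • y = -((1 - l)⁻¹ • (y - (1 - l) • (η : E3))) := by
        rw [smul_sub, smul_smul, inv_mul_cancel₀ h0.ne', one_smul, neg_sub]
      rw [this, norm_neg, norm_smul, Real.norm_eq_abs, abs_of_pos (inv_pos.2 h0),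
        inv_mul_lt_iff₀ h0]
      nlinarith
    refine (measure_mono hsub).trans ((sphereMeasure_ball_le _ (by linarith) (by linarith)).trans
      (ENNReal.ofReal_le_ofReal ?_))
    nlinarith [mul_nonneg hS (sq_nonneg l), sq_nonneg l]
  · refine (measure_mono (Set.subset_univ _)).trans ?_
    rw [← ENNReal.ofReal_toReal (measure_ne_top sphereMeasure Set.univ), ← measureReal_def]
    apply ENNReal.ofReal_le_ofReal
    have : 1 ≤ 4 * l ^ 2 := by nlinarith
    nlinarith [mul_nonneg hS (sub_nonneg.2 this), mul_nonneg hB (sq_nonneg l), sq_nonneg l]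

/-- Pointwise bound of the integrand by a multiple of the indicator of the backward cone. -/
lemma enorm_profileIntegrand_le {a ε : ℝ} (ha : 1 ≤ a) {P : E3 → ℝ}
    (hP : ∀ y : E3, ‖y‖ < 1 → |P y| ≤ ε ^ 2 * (1 - ‖y‖ ^ 2) ^ a)
    (hP0 : ∀ y : E3, 1 ≤ ‖y‖ → P y = 0) {y : E3} {l : ℝ} (hl : 0 < l)
    (hl1 : l ≤ 1) (η : sphere (0 : E3) 1) :
    ‖profileIntegrand P y l η‖ₑ ≤
      (Set.Ioi ((1 - ‖y‖) / 2)).indicator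
        (fun l => ENNReal.ofReal (ε ^ 2 * (2 * (1 - ‖y‖)) * l ^ (-4 : ℝ))) l *
      {η : sphere (0 : E3) 1 | ‖y - (1 - l) • (η : E3)‖ < l}.indicator 1 η := by
  set u := y - (1 - l) • (η : E3)
  have hz : ‖l⁻¹ • u‖ = ‖u‖ / l := by
    rw [norm_smul, Real.norm_eq_abs, abs_of_pos (inv_pos.2 hl), inv_mul_eq_div]
  by_cases hu : ‖u‖ < l
  · have hn : ‖(1 - l) • (η : E3)‖ = 1 - l := by
      rw [norm_smul, Real.norm_eq_abs, abs_of_nonneg (by linarith)]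
      simp
    have htri : |‖y‖ - (1 - l)| ≤ ‖u‖ := hn ▸ abs_norm_sub_norm_le y ((1 - l) • (η : E3))
    have hl2 : l ∈ Set.Ioi ((1 - ‖y‖) / 2) := by
      have := (abs_le.1 htri).1
      simp only [Set.mem_Ioi]
      linarith
    rw [Set.indicator_of_mem hl2, Set.indicator_of_mem (by exact hu), Pi.one_apply, mul_one,
      Real.enorm_eq_ofReal_abs]
    apply ENNReal.ofReal_le_ofReal
    have hz1 : ‖l⁻¹ • u‖ < 1 := by rw [hz]; exact (div_lt_one hl).2 hu
    have hsq : (‖y‖ - (1 - l)) ^ 2 ≤ ‖u‖ ^ 2 := sq_le_sq.2 (by rwa [abs_norm])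
    have hgain : 1 - ‖l⁻¹ • u‖ ^ 2 ≤ 2 * (1 - ‖y‖) / l := by
      rw [hz, div_pow, ← sub_nonneg]
      have : 2 * (1 - ‖y‖) / l - (1 - ‖u‖ ^ 2 / l ^ 2)
          = (2 * (1 - ‖y‖) * l - l ^ 2 + ‖u‖ ^ 2) / l ^ 2 := by
        field_simp
        ring
      rw [this]
      apply div_nonneg _ (sq_nonneg l)
      nlinarith [sq_nonneg (1 - ‖y‖)]
    have hpow : (1 - ‖l⁻¹ • u‖ ^ 2) ^ a ≤ 1 - ‖l⁻¹ • u‖ ^ 2 := by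
      have h1 : 0 < 1 - ‖l⁻¹ • u‖ ^ 2 := by nlinarith [norm_nonneg (l⁻¹ • u)]
      simpa using Real.rpow_le_rpow_of_exponent_ge h1 (by nlinarith [sq_nonneg ‖l⁻¹ • u‖]) ha
    have hPz : |P (l⁻¹ • u)| ≤ ε ^ 2 * (2 * (1 - ‖y‖) / l) :=
      (hP _ hz1).trans (by gcongr; exact hpow.trans hgain)
    have hl3 : 0 < l ^ (-3 : ℝ) := Real.rpow_pos_of_pos hl _
    have hl4 : l ^ (-4 : ℝ) = l ^ (-3 : ℝ) / l := by
      rw [← Real.rpow_sub_one hl.ne']; norm_num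
    rw [profileIntegrand, abs_mul, abs_mul, abs_of_nonneg (by linarith : 0 ≤ 1 - l), abs_of_pos hl3]
    calc (1 - l) * l ^ (-3 : ℝ) * |P (l⁻¹ • u)|
        ≤ 1 * l ^ (-3 : ℝ) * (ε ^ 2 * (2 * (1 - ‖y‖) / l)) := by
          gcongr
          linarith
      _ = ε ^ 2 * (2 * (1 - ‖y‖)) * l ^ (-4 : ℝ) := by rw [hl4]; ring
  · have : P (l⁻¹ • u) = 0 := hP0 _ (by rw [hz]; exact (one_le_div hl).2 (not_lt.1 hu))
    simp [profileIntegrand, u, this]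

/-- The integrand is jointly measurable in `(λ, η)`. -/
lemma measurable_profileIntegrand {P : E3 → ℝ} (hP : Measurable P) (y : E3) :
    Measurable fun q : ℝ × sphere (0 : E3) 1 => profileIntegrand P y q.1 q.2 := by
  unfold profileIntegrand
  have h : Measurable fun q : ℝ × sphere (0 : E3) 1 =>
      q.1⁻¹ • (y - (1 - q.1) • (q.2 : E3)) := by fun_prop
  have := hP.comp h
  fun_prop

/-- The absolute integral of the profile is bounded uniformly in `‖y‖ < 1`. -/
lemma lintegral_profileIntegrand_le {a ε K : ℝ} (ha : 1 ≤ a) (hK : 0 < K)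
    (hcone : ∀ (y : E3) (l : ℝ), 0 < l → l ≤ 1 →
      sphereMeasure {η | ‖y - (1 - l) • (η : E3)‖ < l} ≤ ENNReal.ofReal (K * l ^ 2))
    {P : E3 → ℝ} (hPm : Measurable P)
    (hP : ∀ y : E3, ‖y‖ < 1 → |P y| ≤ ε ^ 2 * (1 - ‖y‖ ^ 2) ^ a)
    (hP0 : ∀ y : E3, 1 ≤ ‖y‖ → P y = 0) {y : E3} (hy : ‖y‖ < 1) :
    ∫⁻ q, ‖profileIntegrand P y q.1 q.2‖ₑ
      ∂((volume.restrict (Set.Ioc (0 : ℝ) 1)).prod sphereMeasure) ≤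
      ENNReal.ofReal (4 * K * ε ^ 2) := by
  have hy0 : 0 < 1 - ‖y‖ := by linarith
  have hy2 : 0 < (1 - ‖y‖) / 2 := by linarith
  set M : ℝ := ε ^ 2 * (2 * (1 - ‖y‖))
  have hM : 0 ≤ M := by positivity
  rw [lintegral_prod _ (measurable_profileIntegrand hPm y).enorm.aemeasurable]
  calc ∫⁻ l in Set.Ioc (0 : ℝ) 1, ∫⁻ η, ‖profileIntegrand P y l η‖ₑ ∂sphereMeasure
      ≤ ∫⁻ l in Set.Ioc (0 : ℝ) 1, (Set.Ioi ((1 - ‖y‖) / 2)).indicator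
          (fun l => ENNReal.ofReal (M * K * l ^ (-2 : ℝ))) l := by
        refine setLIntegral_mono' measurableSet_Ioc fun l hl => ?_
        refine (lintegral_mono fun η =>
          enorm_profileIntegrand_le ha hP hP0 hl.1 hl.2 η).trans ?_
        have hmeas : MeasurableSet {η : sphere (0 : E3) 1 | ‖y - (1 - l) • (η : E3)‖ < l} := by
          apply measurableSet_lt <;> fun_prop
        rw [lintegral_const_mul _ (measurable_one.indicator hmeas), lintegral_indicator_one hmeas]
        by_cases h : l ∈ Set.Ioi ((1 - ‖y‖) / 2)
        · rw [Set.indicator_of_mem h, Set.indicator_of_mem h]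
          refine (mul_le_mul_right (hcone y l hl.1 hl.2) _).trans ?_
          have h4 : 0 < l ^ (-4 : ℝ) := Real.rpow_pos_of_pos hl.1 _
          rw [← ENNReal.ofReal_mul (by positivity)]
          apply ENNReal.ofReal_le_ofReal
          have : l ^ (-2 : ℝ) = l ^ (-4 : ℝ) * l ^ 2 := by
            rw [← Real.rpow_add_natCast hl.1.ne']; norm_num
          rw [this]
          apply le_of_eq
          ring
        · simp [Set.indicator_of_notMem h]
    _ ≤ ∫⁻ l in Set.Ioi ((1 - ‖y‖) / 2), ENNReal.ofReal (M * K * l ^ (-2 : ℝ)) := by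
        rw [← lintegral_indicator measurableSet_Ioi]
        exact setLIntegral_le_lintegral _ _
    _ = ENNReal.ofReal (4 * K * ε ^ 2) := by
        rw [← ofReal_integral_eq_lintegral_ofReal, integral_const_mul,
          integral_Ioi_rpow_of_lt (by norm_num) hy2]
        · congr 1
          have : (-2 : ℝ) + 1 = -1 := by norm_num
          rw [this, Real.rpow_neg_one]
          simp only [M]
          field_simp
          ring
        · exact (integrableOn_Ioi_rpow_of_lt (by norm_num) hy2).const_mul _
        · filter_upwards [ae_restrict_mem measurableSet_Ioi] with l hl
          have : 0 < l ^ (-2 : ℝ) := Real.rpow_pos_of_pos (hy2.trans hl) _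
          positivity

/-- Uniform boundedness of the interior homogeneous profile: the defining integral
converges absolutely, and `|Ũ(y)| ≤ C ε²` uniformly for `|y| < 1`. -/
theorem interior_profile_bounded (δ ε : ℝ) (hδ : δ ∈ Set.Ioo (0 : ℝ) (1 / 2)) (hε : 0 < ε) :
    ∃ C > (0 : ℝ), ∀ P : E3 → ℝ, Measurable P →
      (∀ y : E3, ‖y‖ < 1 → |P y| ≤ ε ^ 2 * (1 - ‖y‖ ^ 2) ^ (2 - 2 * δ)) →
      (∀ y : E3, 1 ≤ ‖y‖ → P y = 0) →
      ∀ y : E3, ‖y‖ < 1 →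
        Integrable (fun q : ℝ × sphere (0 : E3) 1 => profileIntegrand P y q.1 q.2)
          ((volume.restrict (Set.Ioc (0 : ℝ) 1)).prod sphereMeasure) ∧
        |Utilde P y| ≤ C * ε ^ 2 := by
  obtain ⟨K, hK, hcone⟩ := exists_sphereMeasure_cone_le
  refine ⟨4 * K, by positivity, fun P hPm hP hP0 y hy => ?_⟩
  have hbound := lintegral_profileIntegrand_le (by linarith [hδ.2]) hK hcone hPm hP hP0 hy
  have hint : Integrable (fun q : ℝ × sphere (0 : E3) 1 => profileIntegrand P y q.1 q.2)
      ((volume.restrict (Set.Ioc (0 : ℝ) 1)).prod sphereMeasure) :=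
    ⟨(measurable_profileIntegrand hPm y).aestronglyMeasurable,
      hbound.trans_lt ENNReal.ofReal_lt_top⟩
  refine ⟨hint, ?_⟩
  have habs : |∫ l in Set.Ioc (0 : ℝ) 1, ∫ η, profileIntegrand P y l η ∂sphereMeasure| ≤
      4 * K * ε ^ 2 := by
    rw [← integral_prod _ hint, ← ENNReal.ofReal_le_ofReal_iff (by positivity),
      ← Real.enorm_eq_ofReal_abs]
    exact (enorm_integral_le_lintegral_enorm _).trans hbound
  have hpi : 1 / (4 * π) ≤ 1 := by
    rw [div_le_one (by positivity)]
    linarith [Real.pi_gt_three]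
  rw [Utilde, abs_mul, abs_of_pos (by positivity : 0 < 1 / (4 * π))]
  exact (mul_le_of_le_one_left (abs_nonneg _) hpi).trans habs
end
end

section
/- Pointwise decay via exterior radial derivatives of rotations (wave version): There is a constant C > 0 such that for every smooth compactly supported function f : ℝ³ → ℝ, every r₀ > 0 and every ω ∈ S², one has |f(r₀ ω)|² ≤ C r₀^{−1} Σ_{|I| ≤ 2} ∫_{{x : |x| ≥ r₀}} |∂_r Ω^I f(x)|² dx, where Ω^I ranges over compositions of at most two rotation vector fields Ω_{ij}. -/
noncomputable section

open Real MeasureTheory Metric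

/-- The radial derivative `∂_r f(x) = (x/|x|) · ∇f(x)`. -/
def dr (f : E3 → ℝ) (x : E3) : ℝ := fderiv ℝ f x (‖x‖⁻¹ • x)

/-- Rotation vector field `Ω_{ij} f = x_i ∂_{x_j} f − x_j ∂_{x_i} f` on `ℝ³`. -/
def rotS (i j : Fin 3) (f : E3 → ℝ) (x : E3) : ℝ :=
  x i * fderiv ℝ f x (EuclideanSpace.single j 1)
    - x j * fderiv ℝ f x (EuclideanSpace.single i 1)

/-- The index set of rotation pairs `1 ≤ i < j ≤ 3`. -/
def rotPairs : Finset (Fin 3 × Fin 3) := Finset.univ.filter fun q : Fin 3 × Fin 3 => q.1 < q.2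

/-- One-dimensional Sobolev inequality on `(0, 1/4)`. -/
theorem ofReal_sq_le_lintegral_sq_add_sq {h h' : ℝ → ℝ} (hd : ∀ t, HasDerivAt h (h' t) t)
    (hc : Continuous h') :
    ENNReal.ofReal (h 0 ^ 2) ≤ 5 * ∫⁻ t in Set.Ioo (0 : ℝ) (1 / 4),
      (ENNReal.ofReal (h t ^ 2) + ENNReal.ofReal (h' t ^ 2)) := by
  have hh : Continuous h := continuous_iff_continuousAt.2 fun t => (hd t).continuousAt
  have cI : Continuous fun t => h t ^ 2 + h' t ^ 2 := by fun_prop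
  set I := ∫ t in (0 : ℝ)..(1 / 4), (h t ^ 2 + h' t ^ 2) with hI
  have pointwise : ∀ t ∈ Set.Icc (0 : ℝ) (1 / 4), h 0 ^ 2 ≤ h t ^ 2 + I := by
    intro t ht
    have ftc : ∫ s in (0 : ℝ)..t, 2 * h s * h' s = h t ^ 2 - h 0 ^ 2 := by
      refine intervalIntegral.integral_eq_sub_of_hasDerivAt (f := fun s => h s ^ 2)
        (fun s _ => ?_) ((by fun_prop : Continuous _).intervalIntegrable _ _)
      simpa using (hd s).fun_pow 2
    have h1 : ∫ s in (0 : ℝ)..t, -(2 * h s * h' s) ≤ ∫ s in (0 : ℝ)..t, (h s ^ 2 + h' s ^ 2) :=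
      intervalIntegral.integral_mono_on ht.1 ((by fun_prop : Continuous _).intervalIntegrable _ _)
        (cI.intervalIntegrable _ _) fun s _ => by nlinarith [sq_nonneg (h s + h' s)]
    have h2 : ∫ s in (0 : ℝ)..t, (h s ^ 2 + h' s ^ 2) ≤ I :=
      intervalIntegral.integral_mono_interval le_rfl ht.1 ht.2
        (.of_forall fun s => by positivity) (cI.intervalIntegrable _ _)
    rw [intervalIntegral.integral_neg, ftc] at h1
    linarith
  have averaged : ∫ _ in (0 : ℝ)..(1 / 4), h 0 ^ 2 ≤ ∫ t in (0 : ℝ)..(1 / 4), (h t ^ 2 + I) :=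
    intervalIntegral.integral_mono_on (by norm_num) (by simp)
      ((by fun_prop : Continuous _).intervalIntegrable _ _) pointwise
  have h3 : ∫ t in (0 : ℝ)..(1 / 4), h t ^ 2 ≤ I :=
    intervalIntegral.integral_mono_on (by norm_num) ((hh.pow 2).intervalIntegrable _ _)
      (cI.intervalIntegrable _ _) fun t _ => by nlinarith [sq_nonneg (h' t)]
  have csq : Continuous fun t => h t ^ 2 := by fun_prop
  rw [intervalIntegral.integral_add (csq.intervalIntegrable _ _) (by simp),
    intervalIntegral.integral_const, intervalIntegral.integral_const] at averaged
  have real_bound : h 0 ^ 2 ≤ 5 * I := by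
    simp only [smul_eq_mul] at averaged
    linarith
  rw [intervalIntegral.integral_of_le (by norm_num), integral_Ioc_eq_integral_Ioo] at hI
  have hInt : IntegrableOn (fun t => h t ^ 2 + h' t ^ 2) (Set.Ioo (0 : ℝ) (1 / 4)) :=
    (cI.continuousOn.integrableOn_Icc).mono_set Set.Ioo_subset_Icc_self
  calc ENNReal.ofReal (h 0 ^ 2) ≤ ENNReal.ofReal (5 * I) := ENNReal.ofReal_le_ofReal real_bound
    _ = 5 * ENNReal.ofReal I := by rw [ENNReal.ofReal_mul (by norm_num)]; norm_num
    _ = _ := by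
      rw [hI, ofReal_integral_eq_lintegral_ofReal hInt (.of_forall fun t => by positivity)]
      congr 2
      ext t
      exact ENNReal.ofReal_add (sq_nonneg _) (sq_nonneg _)

/-- One-dimensional Hardy-type trace inequality on a half-line. -/
theorem ofReal_mul_sq_le_lintegral_Ioi {h h' : ℝ → ℝ} {r₀ : ℝ}
    (hd : ∀ t, HasDerivAt h (h' t) t) (hc : Continuous h') (hs : ∀ᶠ t in Filter.atTop, h t = 0) :
    ENNReal.ofReal (r₀ * h r₀ ^ 2) ≤
      ∫⁻ r in Set.Ioi r₀, ENNReal.ofReal (r ^ 2 * h' r ^ 2) := by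
  have hh : Continuous h := continuous_iff_continuousAt.2 fun t => (hd t).continuousAt
  obtain ⟨R, hR0, hR⟩ := (hs.and (Filter.eventually_ge_atTop r₀)).exists
  have ftc : ∫ s in r₀..R, (h s ^ 2 + s * (2 * h s * h' s)) = R * h R ^ 2 - r₀ * h r₀ ^ 2 := by
    refine intervalIntegral.integral_eq_sub_of_hasDerivAt (f := fun s => s * h s ^ 2)
      (fun s _ => ?_) ((by fun_prop : Continuous _).intervalIntegrable _ _)
    simpa using (hasDerivAt_id' s).fun_mul ((hd s).fun_pow 2)
  have h1 : ∫ s in r₀..R, -(h s ^ 2 + s * (2 * h s * h' s)) ≤ ∫ s in r₀..R, s ^ 2 * h' s ^ 2 :=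
    intervalIntegral.integral_mono_on hR ((by fun_prop : Continuous _).intervalIntegrable _ _)
      ((by fun_prop : Continuous _).intervalIntegrable _ _)
      fun s _ => by nlinarith [sq_nonneg (h s + s * h' s)]
  rw [intervalIntegral.integral_neg, ftc, hR0] at h1
  have h2 : r₀ * h r₀ ^ 2 ≤ ∫ s in Set.Ioc r₀ R, s ^ 2 * h' s ^ 2 := by
    rw [← intervalIntegral.integral_of_le hR]; linarith
  have hInt : IntegrableOn (fun s => s ^ 2 * h' s ^ 2) (Set.Ioc r₀ R) :=
    ((by fun_prop : Continuous fun s => s ^ 2 * h' s ^ 2).continuousOn.integrableOn_Icc).mono_set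
      Set.Ioc_subset_Icc_self
  calc ENNReal.ofReal (r₀ * h r₀ ^ 2) ≤ _ := ENNReal.ofReal_le_ofReal h2
    _ = ∫⁻ s in Set.Ioc r₀ R, ENNReal.ofReal (s ^ 2 * h' s ^ 2) :=
      ofReal_integral_eq_lintegral_ofReal hInt (.of_forall fun t => by positivity)
    _ ≤ _ := lintegral_mono_set Set.Ioc_subset_Ioi_self

/-- The rotation by angle `θ` in the `(i, j)` coordinate plane. -/
def rotFlow (i j : Fin 3) (θ : ℝ) (y : E3) : E3 :=
  y + ((cos θ - 1) * y i - sin θ * y j) • EuclideanSpace.single i (1 : ℝ)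
    + ((cos θ - 1) * y j + sin θ * y i) • EuclideanSpace.single j (1 : ℝ)

theorem rotFlow_zero (i j : Fin 3) (y : E3) : rotFlow i j 0 y = y := by
  simp [rotFlow]

theorem rotFlow_smul (i j : Fin 3) (θ r : ℝ) (y : E3) :
    rotFlow i j θ (r • y) = r • rotFlow i j θ y := by
  simp only [rotFlow, PiLp.smul_apply, smul_eq_mul]
  module

theorem rotFlow_apply_left {i j : Fin 3} (hij : i ≠ j) (θ : ℝ) (y : E3) :
    rotFlow i j θ y i = cos θ * y i - sin θ * y j := by
  simp [rotFlow, hij]; ring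

theorem rotFlow_apply_right {i j : Fin 3} (hij : i ≠ j) (θ : ℝ) (y : E3) :
    rotFlow i j θ y j = sin θ * y i + cos θ * y j := by
  simp [rotFlow, hij.symm]; ring

theorem rotFlow_apply_of_ne {i j k : Fin 3} (hi : k ≠ i) (hj : k ≠ j) (θ : ℝ) (y : E3) :
    rotFlow i j θ y k = y k := by
  simp [rotFlow, hi, hj]

theorem continuous_rotFlow (i j : Fin 3) : Continuous fun p : ℝ × E3 => rotFlow i j p.1 p.2 := by
  unfold rotFlow; fun_prop

theorem hasDerivAt_comp_rotFlow {g : E3 → ℝ} (hg : Differentiable ℝ g) {i j : Fin 3} (hij : i ≠ j)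
    (y : E3) (θ : ℝ) :
    HasDerivAt (fun t => g (rotFlow i j t y)) (rotS i j g (rotFlow i j θ y)) θ := by
  have hflow : HasDerivAt (fun t => rotFlow i j t y)
      ((-sin θ * y i - cos θ * y j) • EuclideanSpace.single i (1 : ℝ)
        + (-sin θ * y j + cos θ * y i) • EuclideanSpace.single j (1 : ℝ)) θ := by
    have hcos := (hasDerivAt_cos θ).sub_const 1
    have hsin := hasDerivAt_sin θ
    exact ((((hcos.mul_const (y i)).sub (hsin.mul_const (y j))).smul_const _).const_add y).add
      (((hcos.mul_const (y j)).add (hsin.mul_const (y i))).smul_const _)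
  refine ((hg _).hasFDerivAt.comp_hasDerivAt θ hflow).congr_deriv ?_
  simp only [rotS, rotFlow_apply_left hij, rotFlow_apply_right hij, map_add, map_smul, smul_eq_mul]
  ring

theorem contDiff_rotS {f : E3 → ℝ} (hf : ContDiff ℝ (⊤ : ℕ∞) f) (i j : Fin 3) :
    ContDiff ℝ (⊤ : ℕ∞) (rotS i j f) := by
  have hfd : ContDiff ℝ (⊤ : ℕ∞) (fderiv ℝ f) := hf.fderiv_right (by simp)
  have hc (k : Fin 3) : ContDiff ℝ (⊤ : ℕ∞) fun x : E3 => x k := by fun_prop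
  exact ((hc i).mul (hfd.clm_apply contDiff_const)).sub ((hc j).mul (hfd.clm_apply contDiff_const))

theorem hasCompactSupport_rotS {f : E3 → ℝ} (hf : HasCompactSupport f) (i j : Fin 3) :
    HasCompactSupport (rotS i j f) := by
  refine (hf.fderiv (𝕜 := ℝ)).mono fun x hx => ?_
  contrapose! hx
  simp_all [rotS]

theorem rotS_swap (i j : Fin 3) (f : E3 → ℝ) : rotS i j f = -rotS j i f := by
  ext x; simp [rotS]

theorem dr_neg (g : E3 → ℝ) (x : E3) : dr (-g) x = -dr g x := by
  simp [dr, fderiv_neg]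

theorem rotS_neg (i j : Fin 3) (g : E3 → ℝ) : rotS i j (-g) = -rotS i j g := by
  ext x; simp [rotS, fderiv_neg]; ring

theorem measurable_dr {g : E3 → ℝ} (hg : ContDiff ℝ (⊤ : ℕ∞) g) : Measurable (dr g) := by
  have h : Continuous fun x => fderiv ℝ g x x :=
    (hg.continuous_fderiv (by simp)).clm_apply continuous_id
  have : dr g = fun x => ‖x‖⁻¹ * fderiv ℝ g x x := by ext x; simp [dr]
  rw [this]
  exact measurable_norm.inv.mul h.measurable

theorem integrableOn_sq_dr {g : E3 → ℝ} (hg : ContDiff ℝ (⊤ : ℕ∞) g) (hs : HasCompactSupport g)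
    (s : Set E3) : IntegrableOn (fun x => dr g x ^ 2) s := by
  have hfc : Continuous fun x => ‖fderiv ℝ g x‖ ^ 2 := (hg.continuous_fderiv (by simp)).norm.pow 2
  have hfs : HasCompactSupport fun x => ‖fderiv ℝ g x‖ ^ 2 :=
    (hs.fderiv (𝕜 := ℝ)).mono fun x hx => by contrapose! hx; simp_all
  refine Integrable.integrableOn ((hfc.integrable_of_hasCompactSupport hfs).mono'
    ((measurable_dr hg).pow_const 2).aestronglyMeasurable (.of_forall fun x => ?_))
  rw [Real.norm_of_nonneg (sq_nonneg _), ← sq_abs, ← Real.norm_eq_abs]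
  gcongr
  refine (ContinuousLinearMap.le_opNorm _ _).trans (mul_le_of_le_one_right (norm_nonneg _) ?_)
  rw [norm_smul, norm_inv, norm_norm]
  exact inv_mul_le_one

theorem ofReal_mul_sq_le_lintegral_dr {g : E3 → ℝ} (hg : ContDiff ℝ (⊤ : ℕ∞) g)
    (hs : HasCompactSupport g) {r₀ : ℝ} (hr₀ : 0 < r₀) {ω : E3} (hω : ‖ω‖ = 1) :
    ENNReal.ofReal (r₀ * g (r₀ • ω) ^ 2) ≤
      ∫⁻ r in Set.Ioi r₀, ENNReal.ofReal (r ^ 2) * ENNReal.ofReal (dr g (r • ω) ^ 2) := by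
  have hd (t : ℝ) : HasDerivAt (fun r : ℝ => g (r • ω)) (fderiv ℝ g (t • ω) ω) t := by
    have := (hg.differentiable (by simp) (t • ω)).hasFDerivAt.comp_hasDerivAt t
      ((hasDerivAt_id t).smul_const ω)
    simpa [Function.comp_def] using this
  have hc : Continuous fun t : ℝ => fderiv ℝ g (t • ω) ω :=
    ((hg.continuous_fderiv (by simp)).comp (by fun_prop)).clm_apply continuous_const
  have hv : ∀ᶠ t : ℝ in Filter.atTop, g (t • ω) = 0 := by
    obtain ⟨R, hR⟩ := hs.isCompact.isBounded.subset_closedBall (0 : E3)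
    filter_upwards [Filter.eventually_gt_atTop R, Filter.eventually_gt_atTop 0] with t ht ht0
    refine image_eq_zero_of_notMem_tsupport fun hm => ?_
    have := hR hm
    rw [mem_closedBall_zero_iff, norm_smul, hω, Real.norm_of_nonneg ht0.le] at this
    linarith
  refine (ofReal_mul_sq_le_lintegral_Ioi hd hc hv).trans
    (setLIntegral_mono' measurableSet_Ioi fun r hr => ?_)
  have hr0 : 0 < r := hr₀.trans hr
  rw [← ENNReal.ofReal_mul (sq_nonneg r), dr, norm_smul, hω, Real.norm_of_nonneg hr0.le, smul_smul,
    mul_one, inv_mul_cancel₀ hr0.ne', one_smul]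

/-- The coordinates `(a, b, r)` on `ℝ³` obtained by rotating `u` by the angle `a` in the
`(0, 1)` plane, then by the angle `b` in the `(1, 2)` plane, and scaling by `r`. -/
def rotCoord (u p : Fin 3 → ℝ) : Fin 3 → ℝ :=
  ![p 2 * (cos (p 0) * u 0 - sin (p 0) * u 1),
    p 2 * (cos (p 1) * (sin (p 0) * u 0 + cos (p 0) * u 1) - sin (p 1) * u 2),
    p 2 * (sin (p 1) * (sin (p 0) * u 0 + cos (p 0) * u 1) + cos (p 1) * u 2)]

/-- The Jacobian matrix of `rotCoord u`. -/
def rotCoordJacobian (u p : Fin 3 → ℝ) : Matrix (Fin 3) (Fin 3) ℝ :=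
  !![-p 2 * (sin (p 0) * u 0 + cos (p 0) * u 1), 0, cos (p 0) * u 0 - sin (p 0) * u 1;
    p 2 * cos (p 1) * (cos (p 0) * u 0 - sin (p 0) * u 1),
      -p 2 * (sin (p 1) * (sin (p 0) * u 0 + cos (p 0) * u 1) + cos (p 1) * u 2),
      cos (p 1) * (sin (p 0) * u 0 + cos (p 0) * u 1) - sin (p 1) * u 2;
    p 2 * sin (p 1) * (cos (p 0) * u 0 - sin (p 0) * u 1),
      p 2 * (cos (p 1) * (sin (p 0) * u 0 + cos (p 0) * u 1) - sin (p 1) * u 2),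
      sin (p 1) * (sin (p 0) * u 0 + cos (p 0) * u 1) + cos (p 1) * u 2]

theorem hasFDerivAt_rotCoord (u p : Fin 3 → ℝ) :
    HasFDerivAt (rotCoord u) (Matrix.toLin' (rotCoordJacobian u p)).toContinuousLinearMap p := by
  have hp (k : Fin 3) : HasFDerivAt (fun q : Fin 3 → ℝ => q k)
      (ContinuousLinearMap.proj (R := ℝ) (φ := fun _ : Fin 3 => ℝ) k) p :=
    (ContinuousLinearMap.proj (R := ℝ) (φ := fun _ : Fin 3 => ℝ) k).hasFDerivAt
  have hy0 := ((hp 0).cos.mul_const (u 0)).sub ((hp 0).sin.mul_const (u 1))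
  have hy1 := ((hp 0).sin.mul_const (u 0)).add ((hp 0).cos.mul_const (u 1))
  rw [hasFDerivAt_pi']
  intro k
  fin_cases k
  · refine ((hp 2).mul hy0).congr_fderiv ?_
    ext v
    simp [rotCoordJacobian, dotProduct, Fin.sum_univ_three]
    ring
  · refine ((hp 2).mul (((hp 1).cos.mul hy1).sub ((hp 1).sin.mul_const (u 2)))).congr_fderiv ?_
    ext v
    simp [rotCoordJacobian, dotProduct, Fin.sum_univ_three]
    ring
  · refine ((hp 2).mul (((hp 1).sin.mul hy1).add ((hp 1).cos.mul_const (u 2)))).congr_fderiv ?_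
    ext v
    simp [rotCoordJacobian, dotProduct, Fin.sum_univ_three]
    ring

theorem det_rotCoordJacobian {u : Fin 3 → ℝ} (hu : u 0 ^ 2 + u 1 ^ 2 + u 2 ^ 2 = 1)
    (p : Fin 3 → ℝ) :
    (rotCoordJacobian u p).det = p 2 ^ 2 * (sin (p 0) * u 0 + cos (p 0) * u 1) := by
  have ha := sin_sq_add_cos_sq (p 0)
  have hb := sin_sq_add_cos_sq (p 1)
  have h1 : (cos (p 0) * u 0 - sin (p 0) * u 1) ^ 2 + (sin (p 0) * u 0 + cos (p 0) * u 1) ^ 2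
      + u 2 ^ 2 = 1 := by linear_combination hu + (u 0 ^ 2 + u 1 ^ 2) * ha
  rw [rotCoordJacobian, Matrix.det_fin_three]
  simp only [Matrix.of_apply, Matrix.cons_val', Matrix.cons_val_zero, Matrix.cons_val_one,
    Matrix.cons_val, Matrix.cons_val_fin_one]
  generalize cos (p 0) * u 0 - sin (p 0) * u 1 = y0 at *
  generalize sin (p 0) * u 0 + cos (p 0) * u 1 = y1 at *
  linear_combination p 2 ^ 2 * y1 * (h1 + (y0 ^ 2 + y1 ^ 2 + u 2 ^ 2) * hb)

theorem one_div_four_le_abs_rotated {u : Fin 3 → ℝ} (hu : u 0 ^ 2 + u 1 ^ 2 + u 2 ^ 2 = 1)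
    (hmax : ∀ k, |u k| ≤ |u 1|) {a : ℝ} (ha : a ∈ Set.Ioo (0 : ℝ) (1 / 4)) :
    1 / 4 ≤ |sin a * u 0 + cos a * u 1| := by
  have h1 : 1 / 2 ≤ |u 1| := by
    have h0 := sq_le_sq.2 (hmax 0)
    have h2 := sq_le_sq.2 (hmax 2)
    have := sq_abs (u 1)
    nlinarith [abs_nonneg (u 1)]
  have hs0 : 0 ≤ sin a := sin_nonneg_of_nonneg_of_le_pi ha.1.le (by linarith [pi_gt_three, ha.2])
  have hs : sin a ≤ a := sin_le ha.1.le
  have hc : 1 - a ^ 2 / 2 ≤ cos a := one_sub_sq_div_two_le_cos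
  have hc' : 1 / 2 ≤ cos a - sin a := by nlinarith [ha.1, ha.2]
  have hc0 : 0 ≤ cos a := by linarith
  have h3 : cos a * |u 1| - sin a * |u 0| ≤ |sin a * u 0 + cos a * u 1| := by
    have := abs_sub_abs_le_abs_add (cos a * u 1) (sin a * u 0)
    rwa [abs_mul, abs_mul, abs_of_nonneg hs0, abs_of_nonneg hc0, add_comm (cos a * u 1)] at this
  nlinarith [mul_le_mul_of_nonneg_left (hmax 0) hs0]

theorem sum_sq_rotCoord {u : Fin 3 → ℝ} (hu : u 0 ^ 2 + u 1 ^ 2 + u 2 ^ 2 = 1)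
    (p : Fin 3 → ℝ) :
    rotCoord u p 0 ^ 2 + rotCoord u p 1 ^ 2 + rotCoord u p 2 ^ 2 = p 2 ^ 2 := by
  have ha := sin_sq_add_cos_sq (p 0)
  have hb := sin_sq_add_cos_sq (p 1)
  simp only [rotCoord, Matrix.cons_val_zero, Matrix.cons_val_one, Matrix.cons_val]
  linear_combination p 2 ^ 2 * (hu + (u 0 ^ 2 + u 1 ^ 2) * ha
    + ((sin (p 0) * u 0 + cos (p 0) * u 1) ^ 2 + u 2 ^ 2) * hb)

theorem norm_rotCoord {u : Fin 3 → ℝ} (hu : u 0 ^ 2 + u 1 ^ 2 + u 2 ^ 2 = 1) (p : Fin 3 → ℝ) :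
    ‖WithLp.toLp 2 (rotCoord u p)‖ = |p 2| := by
  have h := EuclideanSpace.norm_sq_eq (WithLp.toLp 2 (rotCoord u p))
  rw [Fin.sum_univ_three] at h
  simp only [Real.norm_eq_abs, sq_abs, sum_sq_rotCoord hu p] at h
  rw [← abs_norm]
  exact (sq_eq_sq_iff_abs_eq_abs _ _).1 h

theorem sum_sq_perm_eq_one {ω : E3} (hω : ‖ω‖ = 1) (σ : Equiv.Perm (Fin 3)) :
    ω (σ 0) ^ 2 + ω (σ 1) ^ 2 + ω (σ 2) ^ 2 = 1 := by
  have h := EuclideanSpace.norm_sq_eq ω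
  rw [hω, ← Equiv.sum_comp σ, Fin.sum_univ_three] at h
  simpa using h.symm

theorem injOn_rotCoord {u : Fin 3 → ℝ} (hu : u 0 ^ 2 + u 1 ^ 2 + u 2 ^ 2 = 1)
    (hmax : ∀ k, |u k| ≤ |u 1|) :
    Set.InjOn (rotCoord u) {p | p 0 ∈ Set.Ioo (0 : ℝ) (1 / 4) ∧ p 1 ∈ Set.Ioo (0 : ℝ) (1 / 4)
      ∧ 0 < p 2} := by
  rintro p ⟨hpa, hpb, hpr⟩ q ⟨hqa, hqb, hqr⟩ hpq
  have hr : p 2 = q 2 := by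
    have := sum_sq_rotCoord hu p
    rw [hpq, sum_sq_rotCoord hu q] at this
    exact ((sq_eq_sq₀ hqr.le hpr.le).1 this).symm
  have e0 := congrFun hpq 0
  have e1 := congrFun hpq 1
  have e2 := congrFun hpq 2
  simp only [rotCoord, Matrix.cons_val_zero, Matrix.cons_val_one, Matrix.cons_val, hr,
    mul_right_inj' hqr.ne'] at e0 e1 e2
  have ha : p 0 = q 0 := by
    have hm : (p 0 + q 0) / 2 ∈ Set.Ioo (0 : ℝ) (1 / 4) :=
      ⟨by linarith [hpa.1, hqa.1], by linarith [hpa.2, hqa.2]⟩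
    have hne : sin ((p 0 + q 0) / 2) * u 0 + cos ((p 0 + q 0) / 2) * u 1 ≠ 0 :=
      abs_pos.1 (by linarith [one_div_four_le_abs_rotated hu hmax hm])
    have hz : sin ((p 0 - q 0) / 2) *
        (sin ((p 0 + q 0) / 2) * u 0 + cos ((p 0 + q 0) / 2) * u 1) = 0 := by
      linear_combination (-1 / 2) * e0 + u 0 / 2 * cos_sub_cos (p 0) (q 0)
        - u 1 / 2 * sin_sub_sin (p 0) (q 0)
    have := (sin_eq_zero_iff_of_lt_of_lt (by linarith [pi_gt_three, hpa.1, hqa.2])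
      (by linarith [pi_gt_three, hpa.2, hqa.1])).1 ((mul_eq_zero.1 hz).resolve_right hne)
    linarith
  have hb : p 1 = q 1 := by
    have hne : sin (q 0) * u 0 + cos (q 0) * u 1 ≠ 0 :=
      abs_pos.1 (by linarith [one_div_four_le_abs_rotated hu hmax hqa])
    rw [ha] at e1 e2
    generalize sin (q 0) * u 0 + cos (q 0) * u 1 = y at *
    have hy : y ^ 2 + u 2 ^ 2 ≠ 0 := by positivity
    have hcos : cos (p 1) = cos (q 1) :=
      mul_left_cancel₀ hy (by linear_combination y * e1 + u 2 * e2)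
    exact injOn_cos ⟨hpb.1.le, by linarith [pi_gt_three, hpb.2]⟩
      ⟨hqb.1.le, by linarith [pi_gt_three, hqb.2]⟩ hcos
  ext k
  fin_cases k
  exacts [ha, hb, hr]

theorem rotFlow_comp_eq_rotCoord (σ : Equiv.Perm (Fin 3)) (ω : E3) (p : Fin 3 → ℝ) :
    p 2 • rotFlow (σ 1) (σ 2) (p 1) (rotFlow (σ 0) (σ 1) (p 0) ω) =
      LinearIsometryEquiv.piLpCongrLeft 2 ℝ ℝ σ
        (WithLp.toLp 2 (rotCoord (fun k => ω (σ k)) p)) := by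
  have h01 : σ 0 ≠ σ 1 := by simp
  have h12 : σ 1 ≠ σ 2 := by simp
  have h02 : σ 0 ≠ σ 2 := by simp
  ext k
  obtain ⟨m, rfl⟩ := σ.surjective k
  rw [LinearIsometryEquiv.piLpCongrLeft_apply]
  simp only [Equiv.piCongrLeft'_apply, Equiv.symm_apply_apply, PiLp.smul_apply, smul_eq_mul]
  fin_cases m
  · simp [rotCoord, rotFlow_apply_of_ne h01 h02, rotFlow_apply_left h01]
  · simp [rotCoord, rotFlow_apply_left h12, rotFlow_apply_right h01,
      rotFlow_apply_of_ne h02.symm h12.symm]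
  · simp [rotCoord, rotFlow_apply_right h12, rotFlow_apply_right h01,
      rotFlow_apply_of_ne h02.symm h12.symm]

theorem norm_rotFlow_rotFlow (σ : Equiv.Perm (Fin 3)) {ω : E3} (hω : ‖ω‖ = 1) (a b : ℝ) :
    ‖rotFlow (σ 1) (σ 2) b (rotFlow (σ 0) (σ 1) a ω)‖ = 1 := by
  have h := rotFlow_comp_eq_rotCoord σ ω ![a, b, 1]
  simp only [Matrix.cons_val_zero, Matrix.cons_val_one, Matrix.cons_val, one_smul] at h
  rw [h, LinearIsometryEquiv.norm_map, norm_rotCoord (sum_sq_perm_eq_one hω σ)]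
  simp

/-- The volume-preserving identification of `ℝ × ℝ × ℝ` with `Fin 3 → ℝ`. -/
def tripleEquiv : ℝ × ℝ × ℝ ≃ᵐ (Fin 3 → ℝ) :=
  ((MeasurableEquiv.refl ℝ).prodCongr MeasurableEquiv.finTwoArrow.symm).trans
    (MeasurableEquiv.piFinSuccAbove (fun _ : Fin 3 => ℝ) 0).symm

theorem tripleEquiv_apply (a b r : ℝ) : tripleEquiv (a, b, r) = ![a, b, r] := by
  ext k
  fin_cases k <;> rfl

theorem measurePreserving_tripleEquiv : MeasurePreserving tripleEquiv := by
  have h1 : MeasurePreserving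
      (((MeasurableEquiv.refl ℝ).prodCongr MeasurableEquiv.finTwoArrow.symm :
        ℝ × ℝ × ℝ ≃ᵐ ℝ × (Fin 2 → ℝ))) :=
    (MeasurePreserving.id volume).prod (volume_preserving_finTwoArrow ℝ).symm
  exact (volume_preserving_piFinSuccAbove (fun _ : Fin 3 => ℝ) 0).symm.comp h1

theorem lintegral_rotFlow_le {F : E3 → ENNReal} (hF : Measurable F) {r₀ : ℝ} (hr₀ : 0 < r₀)
    {ω : E3} (hω : ‖ω‖ = 1) (σ : Equiv.Perm (Fin 3)) (hmax : ∀ k, |ω k| ≤ |ω (σ 1)|) :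
    ∫⁻ a in Set.Ioo (0 : ℝ) (1 / 4), ∫⁻ b in Set.Ioo (0 : ℝ) (1 / 4), ∫⁻ r in Set.Ioi r₀,
        ENNReal.ofReal (r ^ 2) * F (r • rotFlow (σ 1) (σ 2) b (rotFlow (σ 0) (σ 1) a ω))
      ≤ 4 * ∫⁻ x in {x : E3 | r₀ ≤ ‖x‖}, F x := by
  set u : Fin 3 → ℝ := fun k => ω (σ k)
  have hu : u 0 ^ 2 + u 1 ^ 2 + u 2 ^ 2 = 1 := sum_sq_perm_eq_one hω σ
  have humax (k : Fin 3) : |u k| ≤ |u 1| := hmax (σ k)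
  set S : Set (Fin 3 → ℝ) := {p | p 0 ∈ Set.Ioo (0 : ℝ) (1 / 4) ∧ p 1 ∈ Set.Ioo (0 : ℝ) (1 / 4)
    ∧ p 2 ∈ Set.Ioi r₀} with hS
  have hSm : MeasurableSet S :=
    (measurable_pi_apply 0 measurableSet_Ioo).inter
      ((measurable_pi_apply 1 measurableSet_Ioo).inter (measurable_pi_apply 2 measurableSet_Ioi))
  set L : (Fin 3 → ℝ) → E3 := fun q =>
    LinearIsometryEquiv.piLpCongrLeft 2 ℝ ℝ σ (WithLp.toLp 2 q) with hL
  have hLmp : MeasurePreserving L :=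
    (LinearIsometryEquiv.piLpCongrLeft 2 ℝ ℝ σ).measurePreserving.comp
      (PiLp.volume_preserving_toLp (Fin 3))
  have hcoord : Continuous (rotCoord u) :=
    continuous_iff_continuousAt.2 fun p => (hasFDerivAt_rotCoord u p).continuousAt
  set G : (Fin 3 → ℝ) → ENNReal := fun p => ENNReal.ofReal (p 2 ^ 2) * F (L (rotCoord u p))
    with hG
  have hGm : Measurable G :=
    (((measurable_pi_apply 2).pow_const 2).ennreal_ofReal).mul
      (hF.comp (hLmp.measurable.comp hcoord.measurable))
  have himage : rotCoord u '' S ⊆ L ⁻¹' {x : E3 | r₀ ≤ ‖x‖} := by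
    rintro _ ⟨p, ⟨-, -, hp⟩, rfl⟩
    have hp0 : 0 < p 2 := hr₀.trans hp
    simpa [hL, norm_rotCoord hu, abs_of_pos hp0] using (le_of_lt hp : r₀ ≤ p 2)
  calc _ = ∫⁻ a in Set.Ioo (0 : ℝ) (1 / 4), ∫⁻ b in Set.Ioo (0 : ℝ) (1 / 4),
          ∫⁻ r in Set.Ioi r₀, G (tripleEquiv (a, b, r)) := by
        refine lintegral_congr fun a => lintegral_congr fun b => lintegral_congr fun r => ?_
        have := rotFlow_comp_eq_rotCoord σ ω ![a, b, r]
        simp only [Matrix.cons_val_zero, Matrix.cons_val_one, Matrix.cons_val] at this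
        rw [tripleEquiv_apply, this]
        rfl
    _ = ∫⁻ z in Set.Ioo (0 : ℝ) (1 / 4) ×ˢ Set.Ioo (0 : ℝ) (1 / 4) ×ˢ Set.Ioi r₀,
          G (tripleEquiv z) := by
        have hGt : Measurable fun z => G (tripleEquiv z) := hGm.comp tripleEquiv.measurable
        rw [Measure.volume_eq_prod, ← Measure.prod_restrict, lintegral_prod _ hGt.aemeasurable]
        refine lintegral_congr fun a => ?_
        have hGa : Measurable fun z : ℝ × ℝ => G (tripleEquiv (a, z)) :=
          hGt.comp measurable_prodMk_left
        rw [Measure.volume_eq_prod, ← Measure.prod_restrict, lintegral_prod _ hGa.aemeasurable]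
    _ = ∫⁻ p in S, G p := by
        rw [← measurePreserving_tripleEquiv.setLIntegral_comp_preimage_emb
          tripleEquiv.measurableEmbedding]
        rfl
    _ ≤ ∫⁻ p in S, 4 * (ENNReal.ofReal
          |(Matrix.toLin' (rotCoordJacobian u p)).toContinuousLinearMap.det|
          * F (L (rotCoord u p))) := by
        refine setLIntegral_mono' hSm fun p hp => ?_
        rw [hG, ← mul_assoc]
        refine mul_le_mul_left ?_ _
        have hdet : (Matrix.toLin' (rotCoordJacobian u p)).toContinuousLinearMap.det
            = p 2 ^ 2 * (sin (p 0) * u 0 + cos (p 0) * u 1) := by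
          rw [← det_rotCoordJacobian hu p, ContinuousLinearMap.det,
            LinearMap.coe_toContinuousLinearMap, LinearMap.det_toLin']
        rw [hdet, abs_mul, abs_of_nonneg (sq_nonneg _),
          ← ENNReal.ofReal_ofNat 4, ← ENNReal.ofReal_mul (by norm_num)]
        refine ENNReal.ofReal_le_ofReal ?_
        nlinarith [one_div_four_le_abs_rotated hu humax hp.1, sq_nonneg (p 2)]
    _ = 4 * ∫⁻ q in rotCoord u '' S, F (L q) := by
        have hinj : Set.InjOn (rotCoord u) S := by
          refine (injOn_rotCoord hu humax).mono ?_
          rintro p ⟨ha, hb, hr⟩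
          exact ⟨ha, hb, hr₀.trans hr⟩
        rw [lintegral_const_mul' _ _ (by simp), lintegral_image_eq_lintegral_abs_det_fderiv_mul
          volume hSm (fun p _ => (hasFDerivAt_rotCoord u p).hasFDerivWithinAt) hinj]
    _ ≤ 4 * ∫⁻ q in L ⁻¹' {x : E3 | r₀ ≤ ‖x‖}, F (L q) := by
        gcongr
    _ = _ := by
        rw [hLmp.setLIntegral_comp_preimage
          (measurableSet_le measurable_const measurable_norm) hF]

/-- One-dimensional Sobolev inequality along the orbits of a coordinate rotation. -/
theorem ofReal_sq_le_lintegral_rotFlow {g : E3 → ℝ} (hg : ContDiff ℝ (⊤ : ℕ∞) g) {i j : Fin 3}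
    (hij : i ≠ j) (r : ℝ) (y : E3) :
    ENNReal.ofReal (g (r • y) ^ 2) ≤ 5 * ∫⁻ θ in Set.Ioo (0 : ℝ) (1 / 4),
      (ENNReal.ofReal (g (r • rotFlow i j θ y) ^ 2)
        + ENNReal.ofReal (rotS i j g (r • rotFlow i j θ y) ^ 2)) := by
  have hc : Continuous fun θ : ℝ => rotS i j g (rotFlow i j θ (r • y)) :=
    (contDiff_rotS hg i j).continuous.comp
      ((continuous_rotFlow i j).comp (by fun_prop : Continuous fun θ : ℝ => (θ, r • y)))
  simpa only [rotFlow_zero, rotFlow_smul] using ofReal_sq_le_lintegral_sq_add_sq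
    (hasDerivAt_comp_rotFlow (hg.differentiable (by simp)) hij (r • y)) hc

theorem lintegral_sq_dr_eq {g : E3 → ℝ} (hg : ContDiff ℝ (⊤ : ℕ∞) g) (hs : HasCompactSupport g)
    (s : Set E3) :
    ∫⁻ x in s, ENNReal.ofReal (dr g x ^ 2) = ENNReal.ofReal (∫ x in s, dr g x ^ 2) :=
  (ofReal_integral_eq_lintegral_ofReal (integrableOn_sq_dr hg hs s)
    (.of_forall fun _ => sq_nonneg _)).symm

theorem exists_rotPairs_rotS_eq {i j : Fin 3} (hij : i ≠ j) :
    ∃ q ∈ rotPairs, ∀ g, rotS i j g = rotS q.1 q.2 g ∨ rotS i j g = -rotS q.1 q.2 g := by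
  rcases hij.lt_or_gt with h | h
  · exact ⟨(i, j), by simp [rotPairs, h], fun g => .inl rfl⟩
  · exact ⟨(j, i), by simp [rotPairs, h], fun g => .inr (rotS_swap i j g)⟩

theorem sq_dr_eq_of_eq_or_eq_neg {g h : E3 → ℝ} (hgh : g = h ∨ g = -h) (x : E3) :
    dr g x ^ 2 = dr h x ^ 2 := by
  rcases hgh with rfl | rfl
  · rfl
  · rw [dr_neg, neg_sq]

theorem lintegral_add_add_add {α : Type*} [MeasurableSpace α] {μ : Measure α}
    {f g h k : α → ENNReal} (hf : Measurable f) (hg : Measurable g) (hh : Measurable h) :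
    ∫⁻ x, ((f x + g x) + (h x + k x)) ∂μ =
      (∫⁻ x, f x ∂μ + ∫⁻ x, g x ∂μ) + (∫⁻ x, h x ∂μ + ∫⁻ x, k x ∂μ) := by
  rw [lintegral_add_left (f := fun x => f x + g x) (hf.add hg), lintegral_add_left hf,
    lintegral_add_left hh]

theorem sq_le_of_perm {f : E3 → ℝ} (hf : ContDiff ℝ (⊤ : ℕ∞) f) (hs : HasCompactSupport f)
    {r₀ : ℝ} (hr₀ : 0 < r₀) {ω : E3} (hω : ‖ω‖ = 1) (σ : Equiv.Perm (Fin 3))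
    (hmax : ∀ k, |ω k| ≤ |ω (σ 1)|) :
    f (r₀ • ω) ^ 2 ≤ 100 * r₀⁻¹ *
      (((∫ x in {x : E3 | r₀ ≤ ‖x‖}, dr f x ^ 2)
        + ∫ x in {x : E3 | r₀ ≤ ‖x‖}, dr (rotS (σ 1) (σ 2) f) x ^ 2)
        + ((∫ x in {x : E3 | r₀ ≤ ‖x‖}, dr (rotS (σ 0) (σ 1) f) x ^ 2)
        + ∫ x in {x : E3 | r₀ ≤ ‖x‖}, dr (rotS (σ 1) (σ 2) (rotS (σ 0) (σ 1) f)) x ^ 2)) := by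
  have h01 : σ 0 ≠ σ 1 := by simp
  have h12 : σ 1 ≠ σ 2 := by simp
  have hA := contDiff_rotS hf (σ 0) (σ 1)
  have hAs := hasCompactSupport_rotS hs (σ 0) (σ 1)
  have hB := contDiff_rotS hf (σ 1) (σ 2)
  have hBs := hasCompactSupport_rotS hs (σ 1) (σ 2)
  have hBA := contDiff_rotS hA (σ 1) (σ 2)
  have hBAs := hasCompactSupport_rotS hAs (σ 1) (σ 2)
  set A := rotS (σ 0) (σ 1) f
  set B := rotS (σ 1) (σ 2) f
  set BA := rotS (σ 1) (σ 2) A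
  let D (g : E3 → ℝ) (x : E3) : ENNReal := ENNReal.ofReal (dr g x ^ 2)
  let F (x : E3) : ENNReal := (D f x + D B x) + (D A x + D BA x)
  have hD {g : E3 → ℝ} (hg : ContDiff ℝ (⊤ : ℕ∞) g) : Measurable (D g) :=
    ((measurable_dr hg).pow_const 2).ennreal_ofReal
  have hF : Measurable F := ((hD hf).add (hD hB)).add ((hD hA).add (hD hBA))
  have radial {g : E3 → ℝ} (hg : ContDiff ℝ (⊤ : ℕ∞) g) (hgs : HasCompactSupport g) {y : E3}
      (hy : ‖y‖ = 1) : ENNReal.ofReal (g (r₀ • y) ^ 2) ≤ ENNReal.ofReal r₀⁻¹ *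
        ∫⁻ r in Set.Ioi r₀, ENNReal.ofReal (r ^ 2) * D g (r • y) := by
    refine le_trans (le_of_eq ?_)
      (mul_le_mul_right (ofReal_mul_sq_le_lintegral_dr hg hgs hr₀ hy) _)
    rw [← ENNReal.ofReal_mul (by positivity), inv_mul_cancel_left₀ hr₀.ne']
  have radialMeas {g : E3 → ℝ} (hg : ContDiff ℝ (⊤ : ℕ∞) g) (y : E3) :
      Measurable fun r : ℝ => ENNReal.ofReal (r ^ 2) * D g (r • y) :=
    (measurable_id.pow_const 2).ennreal_ofReal.mul
      ((hD hg).comp (by fun_prop : Continuous fun r : ℝ => r • y).measurable)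
  have sphere (a b : ℝ) : let y := rotFlow (σ 1) (σ 2) b (rotFlow (σ 0) (σ 1) a ω)
      (ENNReal.ofReal (f (r₀ • y) ^ 2) + ENNReal.ofReal (B (r₀ • y) ^ 2))
        + (ENNReal.ofReal (A (r₀ • y) ^ 2) + ENNReal.ofReal (BA (r₀ • y) ^ 2))
      ≤ ENNReal.ofReal r₀⁻¹ * ∫⁻ r in Set.Ioi r₀, ENNReal.ofReal (r ^ 2) * F (r • y) := by
    intro y
    have hy : ‖y‖ = 1 := norm_rotFlow_rotFlow σ hω a b
    simp only [F, mul_add]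
    rw [lintegral_add_add_add (radialMeas hf y) (radialMeas hB y) (radialMeas hA y),
      mul_add, mul_add, mul_add]
    exact add_le_add (add_le_add (radial hf hs hy) (radial hB hBs hy))
      (add_le_add (radial hA hAs hy) (radial hBA hBAs hy))
  have orbitMeas {g : E3 → ℝ} (hg : ContDiff ℝ (⊤ : ℕ∞) g) (y : E3) :
      Measurable fun b : ℝ => ENNReal.ofReal (g (r₀ • rotFlow (σ 1) (σ 2) b y) ^ 2) := by
    have : Continuous fun b : ℝ => rotFlow (σ 1) (σ 2) b y :=
      (continuous_rotFlow (σ 1) (σ 2)).comp (by fun_prop : Continuous fun b : ℝ => (b, y))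
    exact ((hg.continuous.comp (this.const_smul r₀)).pow 2).measurable.ennreal_ofReal
  have orbit (y : E3) : ENNReal.ofReal (f (r₀ • y) ^ 2) + ENNReal.ofReal (A (r₀ • y) ^ 2) ≤
      5 * ∫⁻ b in Set.Ioo (0 : ℝ) (1 / 4), let z := rotFlow (σ 1) (σ 2) b y
        ((ENNReal.ofReal (f (r₀ • z) ^ 2) + ENNReal.ofReal (B (r₀ • z) ^ 2))
          + (ENNReal.ofReal (A (r₀ • z) ^ 2) + ENNReal.ofReal (BA (r₀ • z) ^ 2))) := by
    rw [lintegral_add_left (f := fun b => _ + _) ((orbitMeas hf y).add (orbitMeas hB y)), mul_add]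
    exact add_le_add (ofReal_sq_le_lintegral_rotFlow hf h12 r₀ y)
      (ofReal_sq_le_lintegral_rotFlow hA h12 r₀ y)
  have total : ENNReal.ofReal (f (r₀ • ω) ^ 2) ≤
      100 * ENNReal.ofReal r₀⁻¹ * ∫⁻ x in {x : E3 | r₀ ≤ ‖x‖}, F x := by
    calc ENNReal.ofReal (f (r₀ • ω) ^ 2)
        ≤ 5 * ∫⁻ a in Set.Ioo (0 : ℝ) (1 / 4),
          (ENNReal.ofReal (f (r₀ • rotFlow (σ 0) (σ 1) a ω) ^ 2)
            + ENNReal.ofReal (A (r₀ • rotFlow (σ 0) (σ 1) a ω) ^ 2)) :=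
          ofReal_sq_le_lintegral_rotFlow hf h01 r₀ ω
      _ ≤ 5 * ∫⁻ a in Set.Ioo (0 : ℝ) (1 / 4), 5 * ∫⁻ b in Set.Ioo (0 : ℝ) (1 / 4),
          ENNReal.ofReal r₀⁻¹ * ∫⁻ r in Set.Ioi r₀, ENNReal.ofReal (r ^ 2) *
            F (r • rotFlow (σ 1) (σ 2) b (rotFlow (σ 0) (σ 1) a ω)) := by
          refine mul_le_mul_right (lintegral_mono fun a => (orbit _).trans ?_) _
          exact mul_le_mul_right (lintegral_mono fun b => sphere a b) _
      _ = 25 * ENNReal.ofReal r₀⁻¹ * ∫⁻ a in Set.Ioo (0 : ℝ) (1 / 4),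
          ∫⁻ b in Set.Ioo (0 : ℝ) (1 / 4), ∫⁻ r in Set.Ioi r₀, ENNReal.ofReal (r ^ 2) *
            F (r • rotFlow (σ 1) (σ 2) b (rotFlow (σ 0) (σ 1) a ω)) := by
          simp_rw [lintegral_const_mul' (ENNReal.ofReal r₀⁻¹) _ ENNReal.ofReal_ne_top]
          rw [lintegral_const_mul' _ _ (by simp),
            lintegral_const_mul' _ _ ENNReal.ofReal_ne_top]
          ring
      _ ≤ 25 * ENNReal.ofReal r₀⁻¹ * (4 * ∫⁻ x in {x : E3 | r₀ ≤ ‖x‖}, F x) :=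
          mul_le_mul_right (lintegral_rotFlow_le hF hr₀ hω σ hmax) _
      _ = _ := by ring
  have hnn (g : E3 → ℝ) : 0 ≤ ∫ x in {x : E3 | r₀ ≤ ‖x‖}, dr g x ^ 2 :=
    integral_nonneg fun _ => sq_nonneg _
  rw [lintegral_add_add_add (hD hf) (hD hB) (hD hA), lintegral_sq_dr_eq hf hs,
    lintegral_sq_dr_eq hA hAs, lintegral_sq_dr_eq hB hBs, lintegral_sq_dr_eq hBA hBAs,
    ← ENNReal.ofReal_add (hnn _) (hnn _), ← ENNReal.ofReal_add (hnn _) (hnn _),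
    ← ENNReal.ofReal_add (add_nonneg (hnn _) (hnn _)) (add_nonneg (hnn _) (hnn _)),
    ← ENNReal.ofReal_ofNat 100, ← ENNReal.ofReal_mul (by norm_num),
    ← ENNReal.ofReal_mul (by positivity)] at total
  refine (ENNReal.ofReal_le_ofReal_iff (mul_nonneg (by positivity) ?_)).1 total
  exact add_nonneg (add_nonneg (hnn _) (hnn _)) (add_nonneg (hnn _) (hnn _))

/-- Pointwise decay via exterior radial derivatives of rotations (wave version):
`|f(r₀ω)|² ≤ C r₀⁻¹ Σ_{|I|≤2} ∫_{|x|≥r₀} |∂_r Ω^I f|² dx`. -/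
theorem pointwise_decay_exterior_wave :
    ∃ C > (0 : ℝ), ∀ f : E3 → ℝ, ContDiff ℝ (⊤ : ℕ∞) f → HasCompactSupport f →
      ∀ r₀ : ℝ, 0 < r₀ → ∀ ω : E3, ‖ω‖ = 1 →
        (f (r₀ • ω)) ^ 2 ≤ C * r₀⁻¹ *
          ((∫ x in {x : E3 | r₀ ≤ ‖x‖}, (dr f x) ^ 2)
            + (∑ q ∈ rotPairs, ∫ x in {x : E3 | r₀ ≤ ‖x‖}, (dr (rotS q.1 q.2 f) x) ^ 2)
            + ∑ q ∈ rotPairs, ∑ q' ∈ rotPairs,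
                ∫ x in {x : E3 | r₀ ≤ ‖x‖}, (dr (rotS q.1 q.2 (rotS q'.1 q'.2 f)) x) ^ 2) := by
  refine ⟨200, by norm_num, fun f hf hs r₀ hr₀ ω hω => ?_⟩
  obtain ⟨j, hj⟩ := Finite.exists_max fun k => |ω k|
  set σ : Equiv.Perm (Fin 3) := Equiv.swap 1 j
  have hσ : σ 1 = j := Equiv.swap_apply_left 1 j
  refine (sq_le_of_perm hf hs hr₀ hω σ (by simpa only [hσ] using hj)).trans ?_
  obtain ⟨qA, hqA, hA⟩ := exists_rotPairs_rotS_eq (show σ 0 ≠ σ 1 by simp)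
  obtain ⟨qB, hqB, hB⟩ := exists_rotPairs_rotS_eq (show σ 1 ≠ σ 2 by simp)
  have hBA : rotS (σ 1) (σ 2) (rotS (σ 0) (σ 1) f) = rotS qB.1 qB.2 (rotS qA.1 qA.2 f) ∨
      rotS (σ 1) (σ 2) (rotS (σ 0) (σ 1) f) = -rotS qB.1 qB.2 (rotS qA.1 qA.2 f) := by
    rcases hA f with h | h <;> rw [h]
    · exact hB _
    · rw [rotS_neg, neg_inj, neg_eq_iff_eq_neg]
      exact (hB _).symm
  simp only [sq_dr_eq_of_eq_or_eq_neg (hA f), sq_dr_eq_of_eq_or_eq_neg (hB f),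
    sq_dr_eq_of_eq_or_eq_neg hBA]
  let T (g : E3 → ℝ) : ℝ := ∫ x in {x : E3 | r₀ ≤ ‖x‖}, dr g x ^ 2
  have hT (g : E3 → ℝ) : 0 ≤ T g := integral_nonneg fun _ => sq_nonneg _
  have first {q : Fin 3 × Fin 3} (hq : q ∈ rotPairs) :
      T (rotS q.1 q.2 f) ≤ ∑ q ∈ rotPairs, T (rotS q.1 q.2 f) :=
    Finset.single_le_sum (f := fun q : Fin 3 × Fin 3 => T (rotS q.1 q.2 f))
      (fun _ _ => hT _) hq
  have second : T (rotS qB.1 qB.2 (rotS qA.1 qA.2 f)) ≤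
      ∑ q ∈ rotPairs, ∑ q' ∈ rotPairs, T (rotS q.1 q.2 (rotS q'.1 q'.2 f)) :=
    (Finset.single_le_sum (f := fun q' : Fin 3 × Fin 3 => T (rotS qB.1 qB.2 (rotS q'.1 q'.2 f)))
      (fun _ _ => hT _) hqA).trans
    (Finset.single_le_sum (f := fun q : Fin 3 × Fin 3 =>
      ∑ q' ∈ rotPairs, T (rotS q.1 q.2 (rotS q'.1 q'.2 f)))
      (fun _ _ => Finset.sum_nonneg fun _ _ => hT _) hqB)
  rw [show (200 : ℝ) * r₀⁻¹ = 100 * r₀⁻¹ * 2 by ring, mul_assoc (100 * r₀⁻¹)]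
  refine mul_le_mul_of_nonneg_left ?_ (by positivity)
  have hA' := first hqA
  have hB' := first hqB
  have hf' := hT f
  have hBA' := hT (rotS qB.1 qB.2 (rotS qA.1 qA.2 f))
  simp only [T] at hA' hB' hf' hBA' second
  linarith
end
end
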